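/- arXiv:1904.12180 — 2 statements merged into one kernel-verified Lean document; each statement's English description precedes it below -/
import Mathlib

section
/- Let (C_n) and (C'_n) be sequences where C_n and C'_n are conjugacy classes of the symmetric group S_n, with cycle counts c_j(n) and c'_j(n) respectively. If P_n → 1 as n → ∞, where P_n is the probability that two independent uniformly random elements π ∈ C_n and π' ∈ C'_n generate a subgroup containing A_n, then (c_1(n) + c_2(n)^{1/2})(c'_1(n) + c'_2(n)^{1/2}) = o(n) as n → ∞. -/
open Filter Asymptotics

/-- The number of `j`-cycles in the cycle decomposition of `π` (fixed points are `1`-cycles). -/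
noncomputable def cycleCount {n : ℕ} (π : Equiv.Perm (Fin n)) (j : ℕ) : ℕ :=
  if j = 1 then Nat.card (Function.fixedPoints ⇑π) else Multiset.count j π.cycleType

/-- The probability that, for `π₁` uniform in the conjugacy class of `π` and `π₂` uniform and
independent in the conjugacy class of `π'`, the subgroup `⟨π₁, π₂⟩` contains `A_n`. -/
noncomputable def genProb (n : ℕ) (π π' : Equiv.Perm (Fin n)) : ℝ :=
  (Nat.card {p : Equiv.Perm (Fin n) × Equiv.Perm (Fin n) //
      IsConj π p.1 ∧ IsConj π' p.2 ∧
      alternatingGroup (Fin n) ≤ Subgroup.closure {p.1, p.2}} : ℝ) /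
  ((Nat.card {σ : Equiv.Perm (Fin n) // IsConj π σ} : ℝ) *
   (Nat.card {σ : Equiv.Perm (Fin n) // IsConj π' σ} : ℝ))

open Finset in
/-- If all translates of `f : G → X` have the same fibres as `f`, then `f` maps the uniform
distribution on `G` to the uniform distribution on its image. -/
theorem card_filter_comp_mul_card_image {G X : Type*} [Group G] [Fintype G] [DecidableEq X]
    (f : G → X) (hf : ∀ g a b, f a = f b → f (g * a) = f (g * b))
    (Q : X → Prop) [DecidablePred Q] :
    #{g | Q (f g)} * #(univ.image f) = #{y ∈ univ.image f | Q y} * Fintype.card G := by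
  have fiber : ∀ a, #{g | f g = f a} = #{g | f g = f 1} := by
    intro a
    refine Finset.card_bij (fun g _ => a⁻¹ * g) ?_ ?_ ?_
    · intro g hg
      have := hf a⁻¹ g a (by simpa using hg)
      simpa using this
    · intro g _ g' _ h
      simpa using h
    · intro g hg
      refine ⟨a * g, ?_, by simp⟩
      have := hf a g 1 (by simpa using hg)
      simpa using this
  have key : ∀ (Q : X → Prop) [DecidablePred Q],
      #{g | Q (f g)} = #{y ∈ univ.image f | Q y} * #{g | f g = f 1} := by
    intro Q _
    rw [Finset.card_eq_sum_card_fiberwise (f := f) (t := {y ∈ univ.image f | Q y})]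
    · rw [Finset.sum_const_nat]
      intro y hy
      simp only [mem_filter, mem_image, mem_univ, true_and] at hy
      obtain ⟨⟨a, rfl⟩, hQ⟩ := hy
      rw [← fiber a, Finset.filter_filter]
      congr 1
      ext g
      simp only [mem_filter, mem_univ, true_and, and_iff_right_iff_imp]
      intro h
      rwa [h]
    · intro g hg
      simpa using hg
  have hG : Fintype.card G = #(univ.image f) * #{g | f g = f 1} := by
    simpa using key (fun _ => True)
  rw [key Q, hG]
  ring

open Finset in
theorem card_perm_trans_mem_mul_card {ι α : Type*} [Fintype ι] [Fintype α] [DecidableEq ι]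
    [DecidableEq α] (e : ι ↪ α) (Q : (ι ↪ α) → Prop) [DecidablePred Q] :
    #{g : Equiv.Perm α | Q (e.trans g.toEmbedding)} * Fintype.card (ι ↪ α) =
      #{y : ι ↪ α | Q y} * Fintype.card (Equiv.Perm α) := by
  have himage : univ.image (fun g : Equiv.Perm α => e.trans g.toEmbedding) = univ := by
    ext y
    obtain ⟨σ, hσ⟩ := Equiv.Perm.exists_extending_pair e y e.injective y.injective
    simp only [mem_image, mem_univ, true_and, iff_true]
    exact ⟨σ, by ext i; simpa using hσ i⟩
  have := card_filter_comp_mul_card_image (fun g : Equiv.Perm α => e.trans g.toEmbedding)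
    (by
      intro g a b h
      ext i
      have := DFunLike.congr_fun h i
      simp at this
      simp [this]) Q
  rwa [himage] at this

open Finset in
/-- Second moment bound for the probability that a random permutation sends some member of the
family `B` into the family `A`. -/
theorem second_moment_perm_trans_mem {ι α : Type*} [Fintype ι] [Fintype α] [DecidableEq ι]
    [DecidableEq α] (A B : Finset (ι ↪ α)) (K : ℕ)
    (hB : ∀ b ∈ B, #{b' ∈ B | ∃ i j, b i = b' j} ≤ K) (N D₁ D₂ : ℝ)
    (hN : N = Fintype.card (Equiv.Perm α)) (hD₁ : D₁ = Fintype.card (ι ↪ α))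
    (hD₂ : D₂ = Fintype.card (ι ⊕ ι ↪ α)) (hD₂0 : 0 < D₂) (hD : D₁ ^ 2 ≤ 2 * D₂) (E : ℝ)
    (hE : E * D₁ ≤ #A * #B) (hE0 : 0 ≤ E) :
    N * E ≤ #{g : Equiv.Perm α | ∃ b ∈ B, b.trans g.toEmbedding ∈ A} * (K + 2 * E) := by
  have hN0 : 0 < N := by rw [hN]; exact_mod_cast Fintype.card_pos
  have hD₁0 : 0 < D₁ := by
    rw [hD₂] at hD₂0
    have : 0 < Fintype.card (ι ⊕ ι ↪ α) := by exact_mod_cast hD₂0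
    obtain ⟨w⟩ := Fintype.card_pos_iff.1 this
    rw [hD₁]
    exact_mod_cast Fintype.card_pos_iff.2 ⟨Function.Embedding.inl.trans w⟩
  set p : (ι ↪ α) → Equiv.Perm α → Prop := fun b g => b.trans g.toEmbedding ∈ A with hp
  set X : Equiv.Perm α → ℝ := fun g => ∑ b ∈ B, if p b g then 1 else 0 with hX
  set S : Finset (Equiv.Perm α) := {g | ∃ b ∈ B, p b g} with hS
  have hX0 : ∀ g, g ∉ S → X g = 0 := by
    intro g hg
    refine Finset.sum_eq_zero fun b hb => ?_
    rw [if_neg]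
    intro h
    exact hg (by simpa [hS] using ⟨b, hb, h⟩)
  have hfirst : ∀ b, (∑ g, if p b g then (1 : ℝ) else 0) = #A * N / D₁ := by
    intro b
    rw [eq_div_iff hD₁0.ne', Finset.sum_boole, hN, hD₁]
    have := card_perm_trans_mem_mul_card b (· ∈ A)
    rw [Finset.filter_univ_mem] at this
    exact_mod_cast this
  have hsecond : ∀ b b', (¬ ∃ i j, b i = b' j) →
      (∑ g, if p b g ∧ p b' g then (1 : ℝ) else 0) ≤ #A ^ 2 * N / D₂ := by
    intro b b' hbb
    push Not at hbb
    let e : ι ⊕ ι ↪ α := ⟨Sum.elim b b', b.injective.sumElim b'.injective hbb⟩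
    let Q : (ι ⊕ ι ↪ α) → Prop := fun y =>
      Function.Embedding.inl.trans y ∈ A ∧ Function.Embedding.inr.trans y ∈ A
    have h1 := card_perm_trans_mem_mul_card e Q
    have h2 : #{y | Q y} ≤ #A ^ 2 := by
      rw [sq, ← Finset.card_product]
      refine Finset.card_le_card_of_injOn
        (fun y => (Function.Embedding.inl.trans y, Function.Embedding.inr.trans y)) ?_ ?_
      · intro y hy
        simpa [Q] using hy
      · intro y _ z _ h
        simp only [Prod.mk.injEq] at h
        ext (i | i)
        · exact DFunLike.congr_fun h.1 i
        · exact DFunLike.congr_fun h.2 i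
    have h3 : ∀ g : Equiv.Perm α, (p b g ∧ p b' g) = Q (e.trans g.toEmbedding) := fun g => rfl
    simp only [h3]
    rw [le_div_iff₀ hD₂0, Finset.sum_boole, hN, hD₂]
    have h4 := h1.le.trans (Nat.mul_le_mul_right _ h2)
    exact_mod_cast h4
  have hsum : ∑ g ∈ S, X g = #A * #B * N / D₁ := by
    rw [Finset.sum_subset (Finset.subset_univ S) (fun g _ hg => hX0 g hg), Finset.sum_comm]
    simp only [hfirst, Finset.sum_const, nsmul_eq_mul]
    ring
  have hsum2 : ∑ g ∈ S, X g ^ 2 ≤ K * (#A * #B * N / D₁) + (#A * #B) ^ 2 * N / D₂ := by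
    have hsq : ∀ g, X g ^ 2 = ∑ b ∈ B, ∑ b' ∈ B, if p b g ∧ p b' g then (1 : ℝ) else 0 := by
      intro g
      rw [sq, Finset.sum_mul_sum]
      refine Finset.sum_congr rfl fun b _ => Finset.sum_congr rfl fun b' _ => ?_
      by_cases h : p b g <;> by_cases h' : p b' g <;> simp [h, h']
    have hbound : ∀ b ∈ B, ∑ b' ∈ B, ∑ g, (if p b g ∧ p b' g then (1 : ℝ) else 0) ≤
        K * (#A * N / D₁) + #B * (#A ^ 2 * N / D₂) := by
      intro b hb
      have hA : 0 ≤ #A * N / D₁ := by positivity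
      have hA2 : 0 ≤ #A ^ 2 * N / D₂ := by positivity
      calc ∑ b' ∈ B, ∑ g, (if p b g ∧ p b' g then (1 : ℝ) else 0)
          ≤ ∑ b' ∈ B, ((if ∃ i j, b i = b' j then #A * N / D₁ else 0) + #A ^ 2 * N / D₂) := by
            refine Finset.sum_le_sum fun b' _ => ?_
            split_ifs with h
            · rw [← hfirst b]
              refine le_add_of_le_of_nonneg (Finset.sum_le_sum fun g _ => ?_) hA2
              by_cases h : p b g <;> by_cases h' : p b' g <;> simp [h, h']
            · rw [zero_add]
              exact hsecond b b' h
        _ = #{b' ∈ B | ∃ i j, b i = b' j} * (#A * N / D₁) + #B * (#A ^ 2 * N / D₂) := by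
            rw [Finset.sum_add_distrib, ← Finset.sum_filter]
            simp only [Finset.sum_const, nsmul_eq_mul]
        _ ≤ _ := by
            gcongr
            exact hB b hb
    calc ∑ g ∈ S, X g ^ 2 ≤ ∑ g, X g ^ 2 :=
          Finset.sum_le_sum_of_subset_of_nonneg (Finset.subset_univ S) fun g _ _ => sq_nonneg _
      _ = ∑ b ∈ B, ∑ b' ∈ B, ∑ g, if p b g ∧ p b' g then (1 : ℝ) else 0 := by
          simp only [hsq]
          rw [Finset.sum_comm]
          exact Finset.sum_congr rfl fun b _ => Finset.sum_comm
      _ ≤ ∑ b ∈ B, (K * (#A * N / D₁) + #B * (#A ^ 2 * N / D₂)) := Finset.sum_le_sum hbound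
      _ = _ := by
          simp only [Finset.sum_const, nsmul_eq_mul]
          ring
  have hCS := (sq_sum_le_card_mul_sum_sq (s := S) (f := X)).trans
    (mul_le_mul_of_nonneg_left hsum2 (Nat.cast_nonneg _))
  rw [hsum] at hCS
  have hS0 : (0 : ℝ) ≤ #S := Nat.cast_nonneg _
  generalize (#S : ℝ) = s at hCS hS0 ⊢
  obtain ⟨e, he⟩ : ∃ e : ℝ, e = #A * #B / D₁ := ⟨_, rfl⟩
  have hEe : E ≤ e := by rw [he, le_div_iff₀ hD₁0]; exact hE
  have hM : (#A * #B : ℝ) = e * D₁ := by rw [he]; field_simp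
  rw [hM] at hCS
  have h1 : e * D₁ * N / D₁ = e * N := by field_simp
  have h2 : (e * D₁) ^ 2 * N / D₂ ≤ 2 * e ^ 2 * N := by
    rw [div_le_iff₀ hD₂0]
    have : e ^ 2 * N * D₁ ^ 2 ≤ e ^ 2 * N * (2 * D₂) :=
      mul_le_mul_of_nonneg_left hD (by positivity)
    linarith
  rw [h1] at hCS
  rcases hE0.eq_or_lt with hE0 | hE0
  · rw [← hE0]
    simpa using mul_nonneg hS0 (Nat.cast_nonneg K)
  have he0 : 0 < e := hE0.trans_le hEe
  have h3 : N * e ≤ s * (K + 2 * e) := by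
    have h4 : (e * N) * (N * e) ≤ (e * N) * (s * (K + 2 * e)) := by
      calc (e * N) * (N * e) = (e * N) ^ 2 := by ring
        _ ≤ s * (K * (e * N) + 2 * e ^ 2 * N) := hCS.trans (by gcongr)
        _ = _ := by ring
    exact le_of_mul_le_mul_left h4 (by positivity)
  have h5 : e * (N * E) ≤ e * (s * (K + 2 * E)) := by
    calc e * (N * E) = E * (N * e) := by ring
      _ ≤ E * (s * (K + 2 * e)) := by gcongr
      _ = s * (K * E + 2 * E * e) := by ring
      _ ≤ s * (K * e + 2 * E * e) := by gcongr
      _ = _ := by ring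
  exact le_of_mul_le_mul_left h5 he0

open scoped Pointwise in
theorem not_alternatingGroup_le_closure_pair {ι α : Type*} [Fintype ι] [Nonempty ι] [Fintype α]
    [DecidableEq α] (a : ι ↪ α) (hι : Fintype.card ι < Fintype.card α)
    (hα : 3 ≤ Fintype.card α) {σ τ : Equiv.Perm α}
    (hσ : ∀ i, ∃ j, σ (a i) = a j) (hτ : ∀ i, ∃ j, τ (a i) = a j) :
    ¬ alternatingGroup α ≤ Subgroup.closure {σ, τ} := by
  intro h
  have hmem : ∀ ρ : Equiv.Perm α, (∀ i, ∃ j, ρ (a i) = a j) →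
      ρ ∈ MulAction.stabilizer (Equiv.Perm α) (Set.range a) := by
    intro ρ hρ
    rw [MulAction.mem_stabilizer_set_iff_smul_set_subset (Set.toFinite _)]
    rintro _ ⟨_, ⟨i, rfl⟩, rfl⟩
    obtain ⟨j, hj⟩ := hρ i
    exact ⟨j, hj.symm⟩
  have hle : Subgroup.closure {σ, τ} ≤ MulAction.stabilizer (Equiv.Perm α) (Set.range a) := by
    rw [Subgroup.closure_le]
    rintro ρ (rfl | rfl)
    exacts [hmem _ hσ, hmem _ hτ]
  obtain ⟨i⟩ := ‹Nonempty ι›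
  obtain ⟨y, hy⟩ : ∃ y, y ∉ Set.range a := by
    by_contra! hall
    exact hι.not_ge (Fintype.card_le_of_surjective a hall)
  have hxy : a i ≠ y := fun e => hy ⟨i, e⟩
  obtain ⟨z, hz⟩ : ∃ z, z ∉ ({a i, y} : Finset α) := by
    by_contra! hall
    have h1 := Finset.card_le_card (fun x _ => hall x : (Finset.univ : Finset α) ⊆ {a i, y})
    have h2 := Finset.card_le_two (a := a i) (b := y)
    rw [Finset.card_univ] at h1
    omega
  simp only [Finset.mem_insert, Finset.mem_singleton, not_or] at hz
  have h3 := (Equiv.Perm.isThreeCycle_swap_mul_swap_same (Ne.symm hz.1) hxy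
    hz.2).mem_alternatingGroup
  have h4 := MulAction.mem_stabilizer_iff.1 (hle (h h3))
  apply hy
  rw [← h4]
  refine ⟨a i, ⟨i, rfl⟩, ?_⟩
  simp [Equiv.swap_apply_of_ne_of_ne hxy.symm (Ne.symm hz.2)]

open Finset in
open scoped Classical in
theorem genProb_le {n : ℕ} (π π' : Equiv.Perm (Fin n)) (δ : ℝ)
    (h : ∀ σ, IsConj π σ → δ * Fintype.card (Equiv.Perm (Fin n)) ≤
      #{g : Equiv.Perm (Fin n) |
        ¬ alternatingGroup (Fin n) ≤ Subgroup.closure {σ, g * π' * g⁻¹}}) :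
    genProb n π π' ≤ 1 - δ := by
  set C : Finset (Equiv.Perm (Fin n)) := {σ | IsConj π σ} with hC
  set C' : Finset (Equiv.Perm (Fin n)) := {σ | IsConj π' σ} with hC'
  set Q : Equiv.Perm (Fin n) → Equiv.Perm (Fin n) → Prop := fun σ τ =>
    alternatingGroup (Fin n) ≤ Subgroup.closure {σ, τ} with hQ
  have himage : univ.image (fun g : Equiv.Perm (Fin n) => g * π' * g⁻¹) = C' := by
    ext τ
    simp [hC', isConj_iff]
  have hN : (0 : ℝ) < Fintype.card (Equiv.Perm (Fin n)) := by exact_mod_cast Fintype.card_pos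
  have hbad : ∀ σ ∈ C, δ * #C' ≤ #{τ ∈ C' | ¬ Q σ τ} := by
    intro σ hσ
    have h1 := card_filter_comp_mul_card_image (fun g : Equiv.Perm (Fin n) => g * π' * g⁻¹)
      (by
        intro g a b hab
        calc g * a * π' * (g * a)⁻¹ = g * (a * π' * a⁻¹) * g⁻¹ := by group
          _ = g * (b * π' * b⁻¹) * g⁻¹ := by rw [show a * π' * a⁻¹ = b * π' * b⁻¹ from hab]
          _ = g * b * π' * (g * b)⁻¹ := by group)
      (fun τ => ¬ Q σ τ)
    rw [himage] at h1
    have h2 := h σ (by simpa [hC] using hσ)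
    have h3 : (#{g : Equiv.Perm (Fin n) | ¬ Q σ (g * π' * g⁻¹)} : ℝ) * #C' =
        #{τ ∈ C' | ¬ Q σ τ} * Fintype.card (Equiv.Perm (Fin n)) := by exact_mod_cast h1
    have h4 : δ * Fintype.card (Equiv.Perm (Fin n)) ≤
        #{g : Equiv.Perm (Fin n) | ¬ Q σ (g * π' * g⁻¹)} := by convert h2
    refine le_of_mul_le_mul_right ?_ hN
    rw [← h3]
    calc δ * #C' * Fintype.card (Equiv.Perm (Fin n))
        = δ * Fintype.card (Equiv.Perm (Fin n)) * #C' := by ring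
      _ ≤ _ := by gcongr
  have hgood : ∀ σ ∈ C, (#{τ ∈ C' | Q σ τ} : ℝ) ≤ (1 - δ) * #C' := by
    intro σ hσ
    have h1 : (#{τ ∈ C' | Q σ τ} : ℝ) + #{τ ∈ C' | ¬ Q σ τ} = #C' := by
      exact_mod_cast Finset.card_filter_add_card_filter_not (Q σ)
    linarith [hbad σ hσ]
  have hnum : (Nat.card {p : Equiv.Perm (Fin n) × Equiv.Perm (Fin n) //
      IsConj π p.1 ∧ IsConj π' p.2 ∧ Q p.1 p.2} : ℝ) = ∑ σ ∈ C, (#{τ ∈ C' | Q σ τ} : ℝ) := by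
    rw [Nat.card_eq_fintype_card, Fintype.card_subtype, ← Nat.cast_sum, ← Finset.card_sigma]
    congr 1
    refine Finset.card_bij (fun p _ => ⟨p.1, p.2⟩) ?_ ?_ ?_
    · intro p hp
      simpa [hC, hC'] using hp
    · rintro ⟨a, b⟩ _ ⟨c, d⟩ _ h
      simpa using h
    · rintro ⟨a, b⟩ hp
      exact ⟨(a, b), by simpa [hC, hC'] using hp, rfl⟩
  have hcard : ∀ ρ : Equiv.Perm (Fin n), Nat.card {σ : Equiv.Perm (Fin n) // IsConj ρ σ} =
      #{σ : Equiv.Perm (Fin n) | IsConj ρ σ} := by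
    intro ρ
    rw [Nat.card_eq_fintype_card, Fintype.card_subtype]
  have hC0 : (0 : ℝ) < #C := by
    exact_mod_cast Finset.card_pos.2 ⟨π, mem_filter.2 ⟨mem_univ _, IsConj.refl _⟩⟩
  have hC'0 : (0 : ℝ) < #C' := by
    exact_mod_cast Finset.card_pos.2 ⟨π', mem_filter.2 ⟨mem_univ _, IsConj.refl _⟩⟩
  rw [genProb, hnum, hcard, hcard, div_le_iff₀ (mul_pos hC0 hC'0)]
  calc ∑ σ ∈ C, (#{τ ∈ C' | Q σ τ} : ℝ) ≤ ∑ σ ∈ C, (1 - δ) * #C' := Finset.sum_le_sum hgood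
    _ = (1 - δ) * (#C * #C') := by
      rw [Finset.sum_const, nsmul_eq_mul]
      ring

theorem genProb_comm {n : ℕ} (π π' : Equiv.Perm (Fin n)) : genProb n π π' = genProb n π' π := by
  rw [genProb, genProb, mul_comm (Nat.card {σ : Equiv.Perm (Fin n) // IsConj π σ} : ℝ)]
  congr 2
  refine Nat.card_congr ((Equiv.prodComm _ _).subtypeEquiv fun p => ?_)
  simp only [Equiv.prodComm_apply, Prod.fst_swap, Prod.snd_swap, Set.pair_comm p.2 p.1]
  tauto

theorem cycleCount_eq_of_isConj {n : ℕ} {π σ : Equiv.Perm (Fin n)} (h : IsConj π σ) (j : ℕ) :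
    cycleCount π j = cycleCount σ j := by
  have hc := Equiv.Perm.isConj_iff_cycleType_eq.1 h
  unfold cycleCount
  split_ifs with hj
  · obtain ⟨g, rfl⟩ := isConj_iff.1 h
    refine Nat.card_congr (g.subtypeEquiv fun x => ?_)
    simp [Function.mem_fixedPoints, Function.IsFixedPt]
  · rw [hc]

open Finset in
theorem cycleCount_one {n : ℕ} (π : Equiv.Perm (Fin n)) : cycleCount π 1 = #{x | π x = x} := by
  rw [cycleCount, if_pos rfl, ← Fintype.card_subtype, ← Nat.card_eq_fintype_card]
  rfl

open Finset in
theorem cycleCount_two_eq_card_filter {n : ℕ} (π : Equiv.Perm (Fin n)) :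
    cycleCount π 2 = #{c ∈ π.cycleFactorsFinset | #c.support = 2} := by
  rw [cycleCount, if_neg (by norm_num), Equiv.Perm.cycleType_def, Multiset.count_map]
  simp only [Function.comp_apply, eq_comm (a := 2)]
  rfl

open Finset in
theorem cycleCount_two_le_card {n : ℕ} (π : Equiv.Perm (Fin n)) :
    cycleCount π 2 ≤ #{x | π x ≠ x ∧ π (π x) = x} := by
  rw [cycleCount_two_eq_card_filter]
  have hex : ∀ c ∈ ({c ∈ π.cycleFactorsFinset | #c.support = 2} : Finset _), ∃ x, x ∈ c.support := by
    intro c hc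
    have h2 := (mem_filter.1 hc).2
    exact Finset.card_pos.1 (by omega)
  rcases isEmpty_or_nonempty (Fin n) with hn | hn
  · rw [Finset.eq_empty_of_forall_notMem fun c hc => hn.false (hex c hc).choose]
    simp
  choose! f hf using hex
  refine Finset.card_le_card_of_injOn f ?_ ?_
  · intro c hc
    have hx := hf c hc
    obtain ⟨hc1, hc2⟩ := mem_filter.1 hc
    have hπ := (Equiv.Perm.mem_cycleFactorsFinset_iff.1 hc1).2
    obtain ⟨a, b, hab, rfl⟩ := Equiv.Perm.card_support_eq_two.1 hc2
    have h1 := hπ _ hx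
    have h2 := hπ _ (Equiv.Perm.apply_mem_support.2 hx)
    have h3 := Equiv.Perm.mem_support.1 hx
    have h4 : Equiv.swap a b (Equiv.swap a b (f (Equiv.swap a b))) = f (Equiv.swap a b) := by simp
    simp only [coe_filter, mem_univ, true_and, Set.mem_ofPred_eq]
    rw [← h1, ← h2]
    exact ⟨h3, h4⟩
  · intro c hc d hd hcd
    by_contra hne
    have h1 := π.cycleFactorsFinset_pairwise_disjoint (mem_filter.1 hc).1 (mem_filter.1 hd).1 hne
    have h2 := Equiv.Perm.mem_support.1 (hf c hc)
    have h3 := Equiv.Perm.mem_support.1 (hf d hd)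
    rw [← hcd] at h3
    exact (h1 (f c)).elim h2 h3

theorem cycleCount_two_le {n : ℕ} (π : Equiv.Perm (Fin n)) : cycleCount π 2 ≤ n :=
  (cycleCount_two_le_card π).trans ((Finset.card_le_univ _).trans (Fintype.card_fin n).le)

open Finset in
theorem genProb_le_of_families {n k : ℕ} (hn : 8 ≤ n) (hk : k = 1 ∨ k = 2)
    (π π' : Equiv.Perm (Fin n)) (A : Equiv.Perm (Fin n) → Finset (Fin k ↪ Fin n))
    (B : Finset (Fin k ↪ Fin n)) (hA : ∀ σ, ∀ a ∈ A σ, ∀ i, ∃ j, σ (a i) = a j)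
    (hB : ∀ b ∈ B, ∀ i, ∃ j, π' (b i) = b j)
    (hmeet : ∀ b ∈ B, #{b' ∈ B | ∃ i j, b i = b' j} ≤ 2) (η : ℝ) (hη0 : 0 ≤ η)
    (hη : ∀ σ, IsConj π σ → η * n.descFactorial k ≤ #(A σ) * #B) :
    genProb n π π' ≤ 1 - η / (2 + 2 * η) := by
  classical
  have hcard₁ : Fintype.card (Fin k ↪ Fin n) = n.descFactorial k := by
    simp [Fintype.card_embedding_eq]
  have hcard₂ : Fintype.card (Fin k ⊕ Fin k ↪ Fin n) = n.descFactorial (k + k) := by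
    simp [Fintype.card_embedding_eq]
  have hpos : 0 < n.descFactorial (k + k) := Nat.descFactorial_pos.2 (by omega)
  have hD : n.descFactorial k ^ 2 ≤ 2 * n.descFactorial (k + k) := by
    obtain ⟨m, rfl⟩ := Nat.exists_eq_add_of_le hn
    rcases hk with rfl | rfl
    · simp only [Nat.descFactorial_succ, Nat.descFactorial_zero,
        show 8 + m - 0 = m + 8 by omega, show 8 + m - 1 = m + 7 by omega]
      nlinarith
    · simp only [Nat.descFactorial_succ, Nat.descFactorial_zero, Nat.reduceAdd,
        show 8 + m - 0 = m + 8 by omega, show 8 + m - 1 = m + 7 by omega,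
        show 8 + m - 2 = m + 6 by omega, show 8 + m - 3 = m + 5 by omega]
      have h1 : (m + 8) * (m + 7) ≤ 2 * ((m + 6) * (m + 5)) := by nlinarith
      have h2 := Nat.mul_le_mul_left ((m + 8) * (m + 7)) h1
      nlinarith
  refine genProb_le π π' _ fun σ hσ => ?_
  have h1 := second_moment_perm_trans_mem (A σ) B 2 (fun b hb => by convert hmeet b hb) _ _ _ rfl rfl rfl
    (by rw [hcard₂]; exact_mod_cast hpos) (by rw [hcard₁, hcard₂]; exact_mod_cast hD) η
    (by rw [hcard₁]; exact hη σ hσ) hη0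
  rw [div_mul_eq_mul_div, div_le_iff₀ (by positivity), mul_comm η]
  refine h1.trans ?_
  push_cast
  refine mul_le_mul_of_nonneg_right ?_ (by positivity)
  norm_cast
  refine Finset.card_le_card fun g hg => ?_
  simp only [mem_filter, mem_univ, true_and] at hg ⊢
  obtain ⟨b, hb, ha⟩ := hg
  have : Nonempty (Fin k) := ⟨⟨0, by omega⟩⟩
  refine not_alternatingGroup_le_closure_pair (b.trans g.toEmbedding) ?_ ?_ (hA σ _ ha) ?_
  · simp only [Fintype.card_fin]
    omega
  · simp only [Fintype.card_fin]
    omega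
  · intro i
    obtain ⟨j, hj⟩ := hB b hb i
    exact ⟨j, by simp [hj]⟩

/-- The injections `Fin k ↪ Fin n` all of whose values are fixed points of `π`. -/
noncomputable def fixedTuples {n : ℕ} (k : ℕ) (π : Equiv.Perm (Fin n)) : Finset (Fin k ↪ Fin n) :=
  {a | ∀ i, π (a i) = a i}

/-- The ordered pairs `(x, y)` of distinct points exchanged by `π`. -/
noncomputable def swappedPairs {n : ℕ} (π : Equiv.Perm (Fin n)) : Finset (Fin 2 ↪ Fin n) :=
  {a | π (a 0) = a 1 ∧ π (a 1) = a 0}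

open Finset in
theorem descFactorial_le_card_fixedTuples {n : ℕ} (k : ℕ) (π : Equiv.Perm (Fin n)) :
    (cycleCount π 1).descFactorial k ≤ #(fixedTuples k π) := by
  have h : Fintype.card (Fin k ↪ {x // π x = x}) = (cycleCount π 1).descFactorial k := by
    rw [Fintype.card_embedding_eq, cycleCount_one, Fintype.card_subtype, Fintype.card_fin]
  rw [← h, ← Finset.card_univ]
  refine Finset.card_le_card_of_injOn (fun a => a.trans (Function.Embedding.subtype _)) ?_ ?_
  · intro a _
    simp [fixedTuples, (a _).2]
  · intro a _ b _ hab
    ext i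
    have := congrArg Fin.val (DFunLike.congr_fun hab i)
    simpa using this

open Finset in
theorem cycleCount_two_le_card_swappedPairs {n : ℕ} (π : Equiv.Perm (Fin n)) :
    cycleCount π 2 ≤ #(swappedPairs π) := by
  refine (cycleCount_two_le_card π).trans
    (Finset.card_le_card_of_surjOn (fun a => a 0) ?_)
  intro x hx
  simp only [coe_filter, mem_univ, true_and, Set.mem_ofPred_eq] at hx
  have hinj : Function.Injective ![x, π x] := by
    intro i j hij
    fin_cases i <;> fin_cases j
    exacts [rfl, absurd hij.symm hx.1, absurd hij hx.1, rfl]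
  refine ⟨⟨![x, π x], hinj⟩, ?_, rfl⟩
  simp [swappedPairs, hx.2]

theorem exists_apply_eq_of_mem_fixedTuples {n k : ℕ} (π : Equiv.Perm (Fin n)) :
    ∀ a ∈ fixedTuples k π, ∀ i, ∃ j, π (a i) = a j := by
  intro a ha i
  exact ⟨i, by simpa [fixedTuples] using (Finset.mem_filter.1 ha).2 i⟩

theorem exists_apply_eq_of_mem_swappedPairs {n : ℕ} (π : Equiv.Perm (Fin n)) :
    ∀ a ∈ swappedPairs π, ∀ i, ∃ j, π (a i) = a j := by
  intro a ha i
  obtain ⟨h0, h1⟩ := (Finset.mem_filter.1 ha).2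
  fin_cases i
  exacts [⟨1, h0⟩, ⟨0, h1⟩]

open Finset in
theorem card_meeting_fixedTuples_one {n : ℕ} (π : Equiv.Perm (Fin n)) :
    ∀ b ∈ fixedTuples 1 π, #{b' ∈ fixedTuples 1 π | ∃ i j, b i = b' j} ≤ 2 := by
  intro b _
  refine (Finset.card_le_one.2 ?_).trans one_le_two
  intro c hc d hd
  obtain ⟨_, i, j, h1⟩ := Finset.mem_filter.1 hc
  obtain ⟨_, i', j', h2⟩ := Finset.mem_filter.1 hd
  ext l
  rw [Subsingleton.elim l j, ← h1, Subsingleton.elim j j', ← h2, Subsingleton.elim i i']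

open Finset in
theorem card_meeting_swappedPairs {n : ℕ} (π : Equiv.Perm (Fin n)) :
    ∀ b ∈ swappedPairs π, #{b' ∈ swappedPairs π | ∃ i j, b i = b' j} ≤ 2 := by
  intro b hb
  obtain ⟨h0, h1⟩ := (Finset.mem_filter.1 hb).2
  refine le_trans (Finset.card_le_card_of_injOn (t := {b 0, b 1}) (fun a => a 0) ?_ ?_)
    Finset.card_le_two
  · intro a ha
    obtain ⟨ha, i, j, hij⟩ := Finset.mem_filter.1 ha
    obtain ⟨a0, a1⟩ := (Finset.mem_filter.1 ha).2
    fin_cases i <;> fin_cases j <;> simp_all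
  · intro a ha c hc hac
    obtain ⟨a0, -⟩ := (Finset.mem_filter.1 (Finset.mem_filter.1 ha).1).2
    obtain ⟨c0, -⟩ := (Finset.mem_filter.1 (Finset.mem_filter.1 hc).1).2
    simp only at hac
    ext l
    fin_cases l
    · simp [hac]
    · simp [← a0, ← c0, hac]

theorem genProb_le_of_fixed_fixed {n : ℕ} (hn : 8 ≤ n) (π π' : Equiv.Perm (Fin n)) {η : ℝ}
    (hη0 : 0 ≤ η) (hη : η * n ≤ cycleCount π 1 * cycleCount π' 1) :
    genProb n π π' ≤ 1 - η / (2 + 2 * η) := by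
  refine genProb_le_of_families hn (.inl rfl) π π' (fixedTuples 1) (fixedTuples 1 π')
    exists_apply_eq_of_mem_fixedTuples (exists_apply_eq_of_mem_fixedTuples π')
    (card_meeting_fixedTuples_one π') η hη0 fun σ hσ => ?_
  have h1 := descFactorial_le_card_fixedTuples 1 σ
  have h2 := descFactorial_le_card_fixedTuples 1 π'
  rw [Nat.descFactorial_one] at h1 h2 ⊢
  rw [cycleCount_eq_of_isConj hσ] at hη
  refine hη.trans ?_
  gcongr

theorem genProb_le_of_fixed_two {n : ℕ} (hn : 8 ≤ n) (π π' : Equiv.Perm (Fin n)) {η : ℝ}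
    (hη0 : 0 ≤ η)
    (hη : η * n ^ 2 ≤ (cycleCount π 1).descFactorial 2 * cycleCount π' 2) :
    genProb n π π' ≤ 1 - η / (2 + 2 * η) := by
  refine genProb_le_of_families hn (.inr rfl) π π' (fixedTuples 2) (swappedPairs π')
    exists_apply_eq_of_mem_fixedTuples (exists_apply_eq_of_mem_swappedPairs π')
    (card_meeting_swappedPairs π') η hη0 fun σ hσ => ?_
  have h1 := descFactorial_le_card_fixedTuples 2 σ
  have h2 := cycleCount_two_le_card_swappedPairs π'
  have h3 : (n.descFactorial 2 : ℝ) ≤ n ^ 2 := by exact_mod_cast Nat.descFactorial_le_pow n 2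
  rw [cycleCount_eq_of_isConj hσ] at hη
  refine (mul_le_mul_of_nonneg_left h3 hη0).trans (hη.trans ?_)
  gcongr

theorem genProb_le_of_two_two {n : ℕ} (hn : 8 ≤ n) (π π' : Equiv.Perm (Fin n)) {η : ℝ}
    (hη0 : 0 ≤ η) (hη : η * n ^ 2 ≤ cycleCount π 2 * cycleCount π' 2) :
    genProb n π π' ≤ 1 - η / (2 + 2 * η) := by
  refine genProb_le_of_families hn (.inr rfl) π π' swappedPairs (swappedPairs π')
    exists_apply_eq_of_mem_swappedPairs (exists_apply_eq_of_mem_swappedPairs π')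
    (card_meeting_swappedPairs π') η hη0 fun σ hσ => ?_
  have h1 := cycleCount_two_le_card_swappedPairs σ
  have h2 := cycleCount_two_le_card_swappedPairs π'
  have h3 : (n.descFactorial 2 : ℝ) ≤ n ^ 2 := by exact_mod_cast Nat.descFactorial_le_pow n 2
  rw [cycleCount_eq_of_isConj hσ] at hη
  refine (mul_le_mul_of_nonneg_left h3 hη0).trans (hη.trans ?_)
  gcongr

/-- If `c₁` fixed points of `π` and `c₂` transpositions of `π'` satisfy `δ n ≤ c₁ √c₂`, then random
conjugates of `π` and `π'` generate with probability bounded away from `1`. -/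
theorem genProb_le_of_fixed_sqrt {n : ℕ} (hn : 8 ≤ n) (π π' : Equiv.Perm (Fin n)) {δ : ℝ}
    (hδ : 0 < δ) (hlarge : 4 ≤ δ ^ 2 * n)
    (h : δ * n ≤ cycleCount π 1 * Real.sqrt (cycleCount π' 2)) :
    genProb n π π' ≤ 1 - (δ ^ 2 / 2) / (2 + 2 * (δ ^ 2 / 2)) := by
  refine genProb_le_of_fixed_two hn π π' (by positivity) ?_
  have hn0 : (0 : ℝ) < n := by exact_mod_cast (by omega : 0 < n)
  have hle : (cycleCount π' 2 : ℝ) ≤ n := by exact_mod_cast cycleCount_two_le π'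
  have hsq : δ ^ 2 * n ^ 2 ≤ cycleCount π 1 ^ 2 * cycleCount π' 2 := by
    have := pow_le_pow_left₀ (by positivity) h 2
    rwa [mul_pow, mul_pow, Real.sq_sqrt (Nat.cast_nonneg _)] at this
  generalize cycleCount π 1 = c at *
  generalize (cycleCount π' 2 : ℝ) = d at *
  have hc : 2 ≤ c := by
    have h1 : δ ^ 2 * n ^ 2 ≤ c ^ 2 * n := hsq.trans (by gcongr)
    have h2 : δ ^ 2 * n ≤ c ^ 2 := by nlinarith
    have h3 : (4 : ℝ) ≤ c ^ 2 := hlarge.trans h2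
    have h4 : 4 ≤ c ^ 2 := by exact_mod_cast h3
    nlinarith
  have hd : 0 ≤ d := by
    by_contra! hd
    have : 0 < δ ^ 2 * (n : ℝ) ^ 2 := by positivity
    nlinarith [mul_nonneg (sq_nonneg (c : ℝ)) (neg_nonneg.2 hd.le)]
  have hdesc : (c : ℝ) ^ 2 ≤ 2 * (c.descFactorial 2 : ℕ) := by
    obtain ⟨m, rfl⟩ := Nat.exists_eq_add_of_le hc
    rw [Nat.descFactorial_succ, Nat.descFactorial_one]
    have : 2 + m - 1 = m + 1 := by omega
    rw [this]
    push_cast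
    nlinarith
  calc δ ^ 2 / 2 * n ^ 2 = δ ^ 2 * n ^ 2 / 2 := by ring
    _ ≤ c ^ 2 * d / 2 := by gcongr
    _ ≤ 2 * (c.descFactorial 2 : ℕ) * d / 2 := by gcongr
    _ = _ := by ring

theorem div_two_add_two_mul_mono {x y : ℝ} (hx : 0 ≤ x) (hxy : x ≤ y) :
    x / (2 + 2 * x) ≤ y / (2 + 2 * y) := by
  rw [div_le_div_iff₀ (by positivity) (by linarith)]
  linarith

/-- If two independent uniformly random elements of the classes of `π n` and `π' n` generate a
subgroup containing `A_n` with probability tending to `1`, then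
`(c₁ + c₂^{1/2})(c'₁ + c'₂^{1/2}) = o(n)`. -/
theorem random_generation_almost_sure_converse
    (π π' : (n : ℕ) → Equiv.Perm (Fin n))
    (h : Tendsto (fun n => genProb n (π n) (π' n)) atTop (nhds 1)) :
    (fun n => ((cycleCount (π n) 1 : ℝ) + Real.sqrt (cycleCount (π n) 2)) *
        ((cycleCount (π' n) 1 : ℝ) + Real.sqrt (cycleCount (π' n) 2))) =o[atTop]
      fun n => (n : ℝ) := by
  rw [isLittleO_iff]
  intro ε hε
  obtain ⟨δ, hδ⟩ : ∃ δ, δ = ε / 4 := ⟨_, rfl⟩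
  have hδ0 : 0 < δ := by linarith
  obtain ⟨η, hη⟩ : ∃ η, η = min δ (δ ^ 2 / 2) := ⟨_, rfl⟩
  have hη0 : 0 < η := by rw [hη]; exact lt_min hδ0 (by positivity)
  have hlim := h.eventually_const_lt (show 1 - η / (2 + 2 * η) < 1 by
    have : 0 < η / (2 + 2 * η) := div_pos hη0 (by linarith)
    linarith)
  have hlarge := (tendsto_natCast_atTop_atTop (R := ℝ)).eventually_ge_atTop (4 / δ ^ 2)
  filter_upwards [hlim, hlarge, eventually_ge_atTop 8] with n h1 h2 hn
  rw [div_le_iff₀ (pow_pos hδ0 2), mul_comm] at h2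
  rw [Real.norm_of_nonneg (by positivity), Real.norm_of_nonneg (by positivity)]
  by_contra! hlt
  refine h1.not_ge ?_
  have hweak : ∀ x, η ≤ x → genProb n (π n) (π' n) ≤ 1 - x / (2 + 2 * x) →
      genProb n (π n) (π' n) ≤ 1 - η / (2 + 2 * η) := fun x hx hg => by
    linarith [div_two_add_two_mul_mono hη0.le hx]
  have hηδ : η ≤ δ := by rw [hη]; exact min_le_left _ _
  have hηsq : η ≤ δ ^ 2 / 2 := by rw [hη]; exact min_le_right _ _
  by_cases c1 : δ * n ≤ cycleCount (π n) 1 * cycleCount (π' n) 1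
  · exact hweak δ hηδ (genProb_le_of_fixed_fixed hn _ _ hδ0.le c1)
  by_cases c2 : δ * n ≤ cycleCount (π n) 1 * Real.sqrt (cycleCount (π' n) 2)
  · exact hweak _ hηsq (genProb_le_of_fixed_sqrt hn _ _ hδ0 h2 c2)
  by_cases c3 : δ * n ≤ cycleCount (π' n) 1 * Real.sqrt (cycleCount (π n) 2)
  · refine hweak _ hηsq ?_
    rw [genProb_comm]
    exact genProb_le_of_fixed_sqrt hn _ _ hδ0 h2 c3
  by_cases c4 : δ * n ≤ Real.sqrt (cycleCount (π n) 2) * Real.sqrt (cycleCount (π' n) 2)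
  · refine hweak (δ ^ 2) (by linarith [sq_nonneg δ]) (genProb_le_of_two_two hn _ _ (sq_nonneg δ) ?_)
    have := pow_le_pow_left₀ (by positivity) c4 2
    rwa [mul_pow, mul_pow, Real.sq_sqrt (Nat.cast_nonneg _), Real.sq_sqrt (Nat.cast_nonneg _)]
      at this
  push Not at c1 c2 c3 c4
  rw [hδ] at c1 c2 c3 c4
  linarith
end

section
/- Let (C_n) and (C'_n) be sequences where C_n and C'_n are conjugacy classes of S_n, with cycle counts c_j(n) and c'_j(n). For π ∈ C_n and π' ∈ C'_n chosen uniformly and independently, let N = N_n(π, π') be the number of orbits of the subgroup ⟨π, π'⟩ on {1,…,n} that have size at most n/2. Then: (1) if c_1(n) + c'_1(n) = o(n^{2/3}) and (c_1(n) + c_2(n)^{1/2})(c'_1(n) + c'_2(n)^{1/2}) = o(n), then E[N_n] → 0 as n → ∞; (2) if c_1(n) + c'_1(n) = O(n^{2/3}), (c_1(n) + c_2(n)^{1/2})(c'_1(n) + c'_2(n)^{1/2}) = O(n), and limsup_{n→∞} (c_2(n) + c'_2(n))/n < 1, then the sequence E[N_n] is bounded. -/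
open Filter Asymptotics

/-- The number of orbits of `⟨a, b⟩` on `{1, …, n}` of size at most `n/2`. -/
noncomputable def smallOrbitCount {n : ℕ} (a b : Equiv.Perm (Fin n)) : ℕ :=
  Nat.card {X : Set (Fin n) //
    (∃ x : Fin n, X = MulAction.orbit (Subgroup.closure {a, b}) x) ∧ 2 * Nat.card X ≤ n}

open scoped Classical in
/-- The expected number of orbits of size at most `n/2` of `⟨π₁, π₂⟩`, where `π₁, π₂` are
uniform and independent in the conjugacy classes of `π, π'` respectively. -/
noncomputable def expectedSmallOrbits (n : ℕ) (π π' : Equiv.Perm (Fin n)) : ℝ :=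
  (∑ p : Equiv.Perm (Fin n) × Equiv.Perm (Fin n),
      if IsConj π p.1 ∧ IsConj π' p.2 then (smallOrbitCount p.1 p.2 : ℝ) else 0) /
  ((Nat.card {σ : Equiv.Perm (Fin n) // IsConj π σ} : ℝ) *
   (Nat.card {σ : Equiv.Perm (Fin n) // IsConj π' σ} : ℝ))

section

open Finset Equiv
open scoped Pointwise

/-- The `k`-element subsets of `{1, …, n}` invariant under `σ`. -/
def invariantSets {n : ℕ} (σ : Perm (Fin n)) (k : ℕ) : Finset (Finset (Fin n)) :=
  (powersetCard k univ).filter fun X => σ • X = X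

theorem mem_invariantSets {n k : ℕ} {σ : Perm (Fin n)} {X : Finset (Fin n)} :
    X ∈ invariantSets σ k ↔ #X = k ∧ σ • X = X := by
  simp [invariantSets]

theorem card_invariantSets_of_isConj {n : ℕ} {σ τ : Perm (Fin n)} (h : IsConj σ τ) (k : ℕ) :
    #(invariantSets τ k) = #(invariantSets σ k) := by
  obtain ⟨g, rfl⟩ := isConj_iff.1 h
  symm
  refine card_bij' (fun X _ => g • X) (fun X _ => g⁻¹ • X) ?_ ?_ (by simp) (by simp)
  · intro X hX
    rw [mem_invariantSets] at hX ⊢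
    refine ⟨by rw [card_smul_finset, hX.1], ?_⟩
    rw [mul_smul, mul_smul, inv_smul_smul, hX.2]
  · intro X hX
    rw [mem_invariantSets] at hX ⊢
    refine ⟨by rw [card_smul_finset, hX.1], ?_⟩
    have := congrArg (g⁻¹ • ·) hX.2
    simpa [mul_smul] using this

theorem exists_perm_smul_finset_eq {n : ℕ} {X Y : Finset (Fin n)} (h : #X = #Y) :
    ∃ g : Perm (Fin n), g • X = Y := by
  have := Set.powersetCard.isPretransitive (α := Fin n) (n := #Y)
  obtain ⟨g, hg⟩ := this.exists_smul_eq (⟨X, h⟩ : Set.powersetCard (Fin n) #Y) ⟨Y, rfl⟩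
  exact ⟨g, congrArg Subtype.val hg⟩

open scoped Classical in
theorem card_conj_stabilizing_eq {n : ℕ} (π : Perm (Fin n)) {X Y : Finset (Fin n)}
    (h : #X = #Y) :
    #{σ : Perm (Fin n) | IsConj π σ ∧ σ • X = X} = #{σ : Perm (Fin n) | IsConj π σ ∧ σ • Y = Y} := by
  obtain ⟨g, rfl⟩ := exists_perm_smul_finset_eq h
  refine card_bij' (fun σ _ => g * σ * g⁻¹) (fun σ _ => g⁻¹ * σ * g) ?_ ?_
    (by simp [mul_assoc]) (by simp [mul_assoc])
  · intro σ hσ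
    simp only [mem_filter, mem_univ, true_and] at hσ ⊢
    refine ⟨hσ.1.trans (isConj_iff.2 ⟨g, rfl⟩), ?_⟩
    rw [mul_smul, mul_smul, inv_smul_smul, hσ.2]
  · intro σ hσ
    simp only [mem_filter, mem_univ, true_and] at hσ ⊢
    refine ⟨hσ.1.trans (isConj_iff.2 ⟨g⁻¹, by simp⟩), ?_⟩
    rw [mul_smul, mul_smul, hσ.2, inv_smul_smul]

open scoped Classical in
/-- Double counting of pairs consisting of a conjugate of `π` and a `k`-set it leaves invariant. -/
theorem choose_mul_card_conj_stabilizing {n : ℕ} (π : Perm (Fin n)) (X : Finset (Fin n)) :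
    n.choose #X * #{σ : Perm (Fin n) | IsConj π σ ∧ σ • X = X} =
      #{σ : Perm (Fin n) | IsConj π σ} * #(invariantSets π #X) := by
  have h₁ : ∑ Y ∈ powersetCard #X (univ : Finset (Fin n)), #{σ : Perm (Fin n) | IsConj π σ ∧ σ • Y = Y} =
      n.choose #X * #{σ : Perm (Fin n) | IsConj π σ ∧ σ • X = X} := by
    rw [sum_congr rfl fun Y hY =>
      card_conj_stabilizing_eq π (mem_powersetCard.1 hY).2, sum_const, card_powersetCard]
    simp
  have h₂ : ∑ σ : Perm (Fin n) with IsConj π σ, #(invariantSets σ #X) =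
      #{σ : Perm (Fin n) | IsConj π σ} * #(invariantSets π #X) := by
    rw [sum_congr rfl fun σ hσ => card_invariantSets_of_isConj (mem_filter.1 hσ).2 _, sum_const,
      smul_eq_mul]
  rw [← h₁, ← h₂]
  simp only [invariantSets, card_filter, sum_filter]
  rw [sum_comm]
  refine sum_congr rfl fun σ _ => ?_
  by_cases h : IsConj π σ <;> simp [h, -isConj_iff]

theorem smallOrbitCount_le {n : ℕ} (a b : Perm (Fin n)) :
    smallOrbitCount a b ≤
      ∑ k ∈ Icc 1 (n / 2), ∑ X ∈ powersetCard k (univ : Finset (Fin n)),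
        if a • X = X ∧ b • X = X then 1 else 0 := by
  classical
  have hdisj : ∀ s : Finset ℕ, (s : Set ℕ).PairwiseDisjoint
      (fun k => (powersetCard k (univ : Finset (Fin n))).filter fun X => a • X = X ∧ b • X = X) := by
    intro s i _ j _ hij
    refine disjoint_left.2 fun X hi hj => hij ?_
    simp only [mem_filter, mem_powersetCard] at hi hj
    rw [← hi.1.2, ← hj.1.2]
  simp_rw [← card_filter]
  rw [← card_biUnion (fun i hi j hj hij => hdisj _ hi hj hij), smallOrbitCount,
    Nat.card_eq_fintype_card, ← card_univ]
  refine card_le_card_of_injOn (fun X => X.1.toFinset) ?_ ?_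
  · rintro ⟨X, ⟨x, rfl⟩, hX⟩ -
    set O := MulAction.orbit (Subgroup.closure {a, b}) x with hO
    have hcard : Nat.card O = #O.toFinset := by
      rw [Set.toFinset_card, Nat.card_eq_fintype_card]
    have hpos : 0 < #O.toFinset := by
      rw [card_pos]; exact ⟨x, by simp [hO, MulAction.mem_orbit_self]⟩
    have hinv : ∀ g ∈ Subgroup.closure {a, b}, g • O.toFinset = O.toFinset := by
      intro g hg
      apply Finset.coe_injective
      rw [Finset.coe_smul_finset, Set.coe_toFinset]
      exact MulAction.smul_orbit (⟨g, hg⟩ : Subgroup.closure {a, b}) x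
    simp only [coe_biUnion, Set.mem_iUnion, mem_coe, mem_filter, mem_powersetCard, mem_Icc]
    refine ⟨#O.toFinset, ⟨hpos, by omega⟩, ⟨subset_univ _, rfl⟩, ?_, ?_⟩
    · exact hinv a (Subgroup.subset_closure (by simp))
    · exact hinv b (Subgroup.subset_closure (by simp))
  · rintro ⟨X, hX⟩ - ⟨Y, hY⟩ - h
    exact Subtype.ext (Set.toFinset_inj.1 h)

theorem expectedSmallOrbits_nonneg (n : ℕ) (π π' : Perm (Fin n)) :
    0 ≤ expectedSmallOrbits n π π' := by
  unfold expectedSmallOrbits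
  refine div_nonneg (sum_nonneg fun p _ => ?_) (by positivity)
  split_ifs <;> positivity

open scoped Classical in
theorem sum_conj_pairs_stabilizing {n : ℕ} (π π' : Perm (Fin n)) (X : Finset (Fin n)) :
    (∑ p : Perm (Fin n) × Perm (Fin n),
      if IsConj π p.1 ∧ IsConj π' p.2 then (if p.1 • X = X ∧ p.2 • X = X then (1 : ℝ) else 0)
        else 0) =
    (#{σ : Perm (Fin n) | IsConj π σ ∧ σ • X = X} : ℝ) *
      #{σ : Perm (Fin n) | IsConj π' σ ∧ σ • X = X} := by
  simp only [card_filter, Nat.cast_sum, Nat.cast_ite, Nat.cast_one, Nat.cast_zero]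
  rw [sum_mul_sum, ← univ_product_univ, sum_product]
  refine sum_congr rfl fun σ _ => sum_congr rfl fun τ _ => ?_
  split_ifs <;> first | (exfalso; tauto) | simp

open scoped Classical in
theorem sum_smallOrbitCount_le {n : ℕ} (π π' : Perm (Fin n)) :
    (∑ p : Perm (Fin n) × Perm (Fin n),
      if IsConj π p.1 ∧ IsConj π' p.2 then (smallOrbitCount p.1 p.2 : ℝ) else 0) ≤
    ∑ k ∈ Icc 1 (n / 2), ∑ X ∈ powersetCard k (univ : Finset (Fin n)),
      (#{σ : Perm (Fin n) | IsConj π σ ∧ σ • X = X} : ℝ) *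
        #{σ : Perm (Fin n) | IsConj π' σ ∧ σ • X = X} := by
  simp_rw [← sum_conj_pairs_stabilizing]
  rw [sum_congr rfl fun k _ => sum_comm, sum_comm]
  refine sum_le_sum fun p _ => ?_
  by_cases hp : IsConj π p.1 ∧ IsConj π' p.2
  · simp only [if_pos hp]
    have := smallOrbitCount_le p.1 p.2
    have h : ((smallOrbitCount p.1 p.2 : ℕ) : ℝ) ≤ _ := Nat.cast_le.2 this
    refine h.trans_eq ?_
    push_cast
    rfl
  · simp only [if_neg hp, sum_const_zero, le_refl]

open scoped Classical in
theorem card_conj_stabilizing {n k : ℕ} (π : Perm (Fin n)) {X : Finset (Fin n)}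
    (hX : X ∈ powersetCard k univ) :
    (#{σ : Perm (Fin n) | IsConj π σ ∧ σ • X = X} : ℝ) =
      #{σ : Perm (Fin n) | IsConj π σ} * #(invariantSets π k) / n.choose k := by
  obtain rfl := (mem_powersetCard.1 hX).2
  have hk : #X ≤ n := by simpa using card_le_univ X
  have hch : (0 : ℝ) < n.choose #X := by exact_mod_cast Nat.choose_pos hk
  rw [eq_div_iff hch.ne', mul_comm]
  exact_mod_cast choose_mul_card_conj_stabilizing π X

theorem expectedSmallOrbits_le (n : ℕ) (π π' : Perm (Fin n)) :
    expectedSmallOrbits n π π' ≤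
      ∑ k ∈ Icc 1 (n / 2),
        (#(invariantSets π k) : ℝ) * #(invariantSets π' k) / n.choose k := by
  classical
  have hcard : ∀ τ : Perm (Fin n), Nat.card {σ : Perm (Fin n) // IsConj τ σ} =
      #{σ : Perm (Fin n) | IsConj τ σ} := fun τ => by
    rw [Nat.card_eq_fintype_card, Fintype.card_subtype]
  have hpos : ∀ τ : Perm (Fin n), (0 : ℝ) < #{σ : Perm (Fin n) | IsConj τ σ} := fun τ =>
    Nat.cast_pos.2 (card_pos.2 ⟨τ, mem_filter.2 ⟨mem_univ _, IsConj.refl _⟩⟩)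
  rw [expectedSmallOrbits, hcard, hcard, div_le_iff₀ (mul_pos (hpos _) (hpos _))]
  refine (sum_smallOrbitCount_le π π').trans_eq ?_
  rw [sum_mul]
  refine sum_congr rfl fun k hk => ?_
  have hk : k ≤ n := by have := (mem_Icc.1 hk).2; omega
  have hch : (0 : ℝ) < n.choose k := by exact_mod_cast Nat.choose_pos hk
  rw [sum_congr rfl fun X hX => by
      rw [card_conj_stabilizing π hX, card_conj_stabilizing π' hX], sum_const, card_powersetCard,
    card_univ, Fintype.card_fin, nsmul_eq_mul]
  generalize (#{σ : Perm (Fin n) | IsConj π σ} : ℝ) = A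
  generalize (#{σ : Perm (Fin n) | IsConj π' σ} : ℝ) = A'
  field_simp

theorem perm_smul_eq_iff_of_mem {n : ℕ} {σ : Perm (Fin n)} {X : Finset (Fin n)} (h : σ • X = X)
    {x y : Fin n} (hxy : σ.SameCycle x y) : x ∈ X ↔ y ∈ X := by
  obtain ⟨i, rfl⟩ := hxy
  have hi : (σ ^ i) • X = X := by
    have : σ ∈ MulAction.stabilizer (Perm (Fin n)) X := h
    exact Subgroup.zpow_mem _ this i
  conv_rhs => rw [← hi]
  exact (smul_mem_smul_finset_iff (σ ^ i)).symm

/-- An invariant set is the disjoint union of its fixed points and the cycles it contains. -/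
theorem invariant_eq_union {n : ℕ} {σ : Perm (Fin n)} {X : Finset (Fin n)} (h : σ • X = X) :
    X = (σ.supportᶜ.filter (· ∈ X)) ∪
      (σ.cycleFactorsFinset.filter (·.support ⊆ X)).biUnion Perm.support := by
  ext x
  simp only [mem_union, mem_filter, mem_biUnion, mem_compl]
  constructor
  · intro hx
    by_cases hxs : x ∈ σ.support
    · refine Or.inr ⟨σ.cycleOf x, ⟨Perm.cycleOf_mem_cycleFactorsFinset_iff.2 hxs, ?_⟩, ?_⟩
      · intro y hy
        exact (perm_smul_eq_iff_of_mem h (Perm.mem_support_cycleOf_iff.1 hy).1).1 hx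
      · exact Perm.mem_support_cycleOf_iff.2 ⟨Perm.SameCycle.refl _ _, hxs⟩
    · exact Or.inl ⟨hxs, hx⟩
  · rintro (hx | ⟨c, hc, hx⟩)
    · exact hx.2
    · exact hc.2 hx

theorem card_invariant_eq {n : ℕ} {σ : Perm (Fin n)} {X : Finset (Fin n)} (h : σ • X = X) :
    #X = #(σ.supportᶜ.filter (· ∈ X)) +
      ∑ c ∈ σ.cycleFactorsFinset.filter (·.support ⊆ X), #c.support := by
  conv_lhs => rw [invariant_eq_union h]
  rw [card_union_of_disjoint, card_biUnion]
  · intro c hc d hd hcd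
    exact (Perm.cycleFactorsFinset_pairwise_disjoint σ (mem_filter.1 hc).1
      (mem_filter.1 hd).1 hcd).disjoint_support
  · rw [disjoint_biUnion_right]
    intro c hc
    refine disjoint_left.2 fun x hx hxc => ?_
    exact mem_compl.1 (mem_filter.1 hx).1
      (Perm.mem_cycleFactorsFinset_support_le (mem_filter.1 hc).1 hxc)

/-- The generating function of the invariant sets dominates each of its terms. -/
theorem card_invariantSets_mul_pow_le {n : ℕ} (σ : Perm (Fin n)) (k : ℕ) {x : ℝ} (hx : 0 ≤ x) :
    #(invariantSets σ k) * x ^ k ≤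
      (1 + x) ^ #σ.supportᶜ * (σ.cycleType.map fun j => 1 + x ^ j).prod := by
  have hprod : (σ.cycleType.map fun j => 1 + x ^ j).prod =
      ∏ c ∈ σ.cycleFactorsFinset, (1 + x ^ #c.support) := by
    rw [Perm.cycleType_def, Multiset.map_map]
    rfl
  rw [hprod, prod_one_add, ← prod_const (1 + x), prod_one_add, sum_mul_sum, ← sum_product']
  let φ : Finset (Fin n) → Finset (Fin n) × Finset (Perm (Fin n)) := fun X =>
    (σ.supportᶜ.filter (· ∈ X), σ.cycleFactorsFinset.filter (·.support ⊆ X))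
  have hinj : Set.InjOn φ (invariantSets σ k : Set (Finset (Fin n))) := by
    intro X hX Y hY hXY
    have hX' := invariant_eq_union (mem_invariantSets.1 hX).2
    have hY' := invariant_eq_union (mem_invariantSets.1 hY).2
    obtain ⟨h₁, h₂⟩ := Prod.mk.inj hXY
    rw [hX', hY', h₁, h₂]
  calc (#(invariantSets σ k) * x ^ k : ℝ)
      = ∑ X ∈ invariantSets σ k,
          (∏ _i ∈ (φ X).1, x) * ∏ c ∈ (φ X).2, x ^ #c.support := by
        rw [← nsmul_eq_mul, ← sum_const]
        refine sum_congr rfl fun X hX => ?_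
        rw [mem_invariantSets] at hX
        rw [prod_const, prod_pow_eq_pow_sum, ← pow_add, ← hX.1, ← card_invariant_eq hX.2]
    _ = ∑ p ∈ (invariantSets σ k).image φ, (∏ _i ∈ p.1, x) * ∏ c ∈ p.2, x ^ #c.support :=
        (sum_image (f := fun p : Finset (Fin n) × Finset (Perm (Fin n)) =>
          (∏ _i ∈ p.1, x) * ∏ c ∈ p.2, x ^ #c.support) hinj).symm
    _ ≤ _ := by
        refine sum_le_sum_of_subset_of_nonneg ?_ fun p _ _ =>
          mul_nonneg (prod_nonneg fun _ _ => hx) (prod_nonneg fun _ _ => pow_nonneg hx _)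
        intro p hp
        obtain ⟨X, -, rfl⟩ := mem_image.1 hp
        simp only [mem_product, mem_powerset]
        exact ⟨filter_subset _ _, filter_subset _ _⟩

theorem one_add_pow_le_rpow {x : ℝ} (hx : 0 ≤ x) {j : ℕ} (hj : 3 ≤ j) :
    1 + x ^ j ≤ (1 + x ^ 3) ^ ((j : ℝ) / 3) := by
  have hj' : (1 : ℝ) ≤ (j : ℝ) / 3 := by
    rw [le_div_iff₀ (by norm_num)]; exact_mod_cast (by omega)
  have h := NNReal.add_rpow_le_rpow_add 1 (⟨x, hx⟩ ^ 3) hj'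
  have h' : (1 : ℝ) ^ ((j : ℝ) / 3) + (x ^ 3) ^ ((j : ℝ) / 3) ≤ (1 + x ^ 3) ^ ((j : ℝ) / 3) := by
    exact_mod_cast h
  have e : (x ^ 3) ^ ((j : ℝ) / 3) = x ^ j := by
    rw [← Real.rpow_natCast x 3, ← Real.rpow_mul hx, ← Real.rpow_natCast x j]
    congr 1
    push_cast
    ring
  rwa [Real.one_rpow, e] at h'

theorem prod_one_add_pow_le {x : ℝ} (hx : 0 ≤ x) (m : Multiset ℕ) (hm : ∀ j ∈ m, 2 ≤ j) :
    (m.map fun j => 1 + x ^ j).prod ≤ (1 + x ^ 2) ^ m.count 2 *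
      (1 + x ^ 3) ^ (((m.sum : ℝ) - 2 * m.count 2) / 3) := by
  have hpos : 0 < 1 + x ^ 3 := by positivity
  induction m using Multiset.induction_on with
  | empty => simp
  | cons j m ih =>
    have ih := ih fun i hi => hm i (Multiset.mem_cons_of_mem hi)
    have hj := hm j (Multiset.mem_cons_self j m)
    rw [Multiset.map_cons, Multiset.prod_cons, Multiset.sum_cons]
    obtain rfl | hj3 : j = 2 ∨ 3 ≤ j := by omega
    · rw [Multiset.count_cons_self]
      refine (mul_le_mul_of_nonneg_left ih (by positivity)).trans_eq ?_
      rw [pow_succ' (1 + x ^ 2), mul_assoc]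
      congr 3
      push_cast
      ring
    · rw [Multiset.count_cons_of_ne (by omega)]
      refine (mul_le_mul (one_add_pow_le_rpow hx hj3) ih ?_ (by positivity)).trans_eq ?_
      · exact Multiset.prod_nonneg fun a ha => by
          obtain ⟨i, -, rfl⟩ := Multiset.mem_map.1 ha
          positivity
      · rw [mul_left_comm, ← Real.rpow_add hpos]
        push_cast
        ring_nf

theorem cycleCount_one_s7 {n : ℕ} (σ : Perm (Fin n)) : cycleCount σ 1 = #σ.supportᶜ := by
  rw [cycleCount, if_pos rfl, Nat.card_eq_fintype_card, Perm.card_fixedPoints, Perm.sum_cycleType,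
    card_compl]

theorem cycleCount_two {n : ℕ} (σ : Perm (Fin n)) : cycleCount σ 2 = σ.cycleType.count 2 := by
  rw [cycleCount, if_neg (by norm_num)]

theorem card_invariantSets_mul_pow_le_cycleCount {n : ℕ} (σ : Perm (Fin n)) (k : ℕ) {x : ℝ}
    (hx : 0 ≤ x) :
    #(invariantSets σ k) * x ^ k ≤ (1 + x) ^ cycleCount σ 1 * ((1 + x ^ 2) ^ cycleCount σ 2 *
      (1 + x ^ 3) ^ (((n : ℝ) - cycleCount σ 1 - 2 * cycleCount σ 2) / 3)) := by
  refine (card_invariantSets_mul_pow_le σ k hx).trans ?_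
  rw [cycleCount_one_s7, cycleCount_two]
  refine mul_le_mul_of_nonneg_left ?_ (by positivity)
  refine (prod_one_add_pow_le hx σ.cycleType fun j => Perm.two_le_of_mem_cycleType).trans_eq ?_
  have : (σ.cycleType.sum : ℝ) = n - #σ.supportᶜ := by
    rw [Perm.sum_cycleType, eq_sub_iff_add_eq]
    exact_mod_cast (card_add_card_compl σ.support).trans (Fintype.card_fin n)
  rw [this]

theorem cycleCount_one_add_two_mul_le {n : ℕ} (σ : Perm (Fin n)) :
    cycleCount σ 1 + 2 * cycleCount σ 2 ≤ n := by
  have h₁ : #σ.support + #σ.supportᶜ = n := (card_add_card_compl σ.support).trans (Fintype.card_fin n)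
  have h₂ : 2 * σ.cycleType.count 2 ≤ σ.cycleType.sum := by
    obtain ⟨t, ht⟩ := Multiset.le_iff_exists_add.1
      (Multiset.le_count_iff_replicate_le.1 (le_refl (σ.cycleType.count 2)))
    conv_rhs => rw [ht]
    simp [mul_comm]
  rw [cycleCount_one_s7, cycleCount_two]
  rw [Perm.sum_cycleType] at h₂
  omega

theorem factorial_le_exp_mul_sqrt_mul {n : ℕ} (hn : 1 ≤ n) :
    (n.factorial : ℝ) ≤ Real.exp 1 * √n * (n / Real.exp 1) ^ n := by
  have h : Stirling.stirlingSeq n ≤ Real.exp 1 / √2 := by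
    obtain ⟨m, rfl⟩ := Nat.exists_eq_add_of_le' hn
    rw [← Stirling.stirlingSeq_one]
    exact Stirling.stirlingSeq'_antitone (Nat.zero_le m)
  have hn' : (0 : ℝ) < n := by exact_mod_cast hn
  rw [Stirling.stirlingSeq, div_le_iff₀ (by positivity)] at h
  refine h.trans_eq ?_
  rw [Real.sqrt_mul (by norm_num)]
  field_simp

/-- The entropy lower bound for binomial coefficients. -/
theorem add_pow_le_choose_mul {k j : ℕ} (hk : 1 ≤ k) (hj : 1 ≤ j) :
    ((k : ℝ) + j) ^ (k + j) ≤
      (k + j).choose k * (Real.exp 2 * √k) * ((k : ℝ) ^ k * (j : ℝ) ^ j) := by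
  have hk' : (0 : ℝ) < k := by exact_mod_cast hk
  have hj' : (0 : ℝ) < j := by exact_mod_cast hj
  have h₁ := Stirling.le_factorial_stirling (k + j)
  have h₂ := factorial_le_exp_mul_sqrt_mul hk
  have h₃ := factorial_le_exp_mul_sqrt_mul hj
  have h₄ : ((k + j).factorial : ℝ) = (k + j).choose k * (k.factorial * j.factorial) := by
    rw [← Nat.add_choose_mul_factorial_mul_factorial, Nat.choose_symm_add]
    push_cast
    ring
  have h₅ : √(2 * Real.pi * (k + j : ℕ)) * ((k + j : ℕ) / Real.exp 1) ^ (k + j) ≤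
      (k + j).choose k * ((Real.exp 1 * √k * (k / Real.exp 1) ^ k) *
        (Real.exp 1 * √j * (j / Real.exp 1) ^ j)) := by
    rw [h₄] at h₁
    exact h₁.trans (by gcongr)
  have h₆ : √j ≤ √(2 * Real.pi * (k + j : ℕ)) := by
    apply Real.sqrt_le_sqrt
    push_cast
    nlinarith [Real.pi_gt_three]
  have h₇ := (mul_le_mul_of_nonneg_right h₆ (by positivity)).trans h₅
  have hsj : 0 < √(j : ℝ) := Real.sqrt_pos.2 hj'
  have he : Real.exp 2 = Real.exp 1 * Real.exp 1 := by rw [← Real.exp_add]; norm_num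
  rw [he]
  refine le_of_mul_le_mul_left ?_ (show 0 < √(j : ℝ) / Real.exp 1 ^ (k + j) by positivity)
  calc _ = √(j : ℝ) * ((k + j : ℕ) / Real.exp 1) ^ (k + j) := by
        push_cast; rw [div_pow]; ring
    _ ≤ _ := h₇
    _ = _ := by rw [div_pow, div_pow, pow_add]; field_simp

theorem one_add_cube_rpow_le {z : ℝ} (hz : 0 ≤ z) (hz1 : z ≤ 1) :
    (1 + z ^ 3) ^ ((2 : ℝ) / 3) ≤ (1 + z ^ 2) * Real.exp (-(z ^ 2 / 24)) := by
  have h₁ : (1 + z ^ 3) ^ 2 ≤ ((1 + z ^ 2) * Real.exp (-(z ^ 2 / 24))) ^ 3 := by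
    have he : Real.exp (-(z ^ 2 / 24)) ^ 3 = Real.exp (-(z ^ 2 / 8)) := by
      rw [← Real.exp_nat_mul]; congr 1; push_cast; ring
    rw [mul_pow, he]
    have h₂ : 1 - z ^ 2 / 8 ≤ Real.exp (-(z ^ 2 / 8)) := by
      linarith [Real.add_one_le_exp (-(z ^ 2 / 8))]
    have hz2 : z ^ 2 ≤ 1 := pow_le_one₀ hz hz1
    refine le_trans ?_ (mul_le_mul_of_nonneg_left h₂ (by positivity))
    have h₃ : (1 + z ^ 2) ^ 3 ≤ 8 := by
      calc (1 + z ^ 2) ^ 3 ≤ 2 ^ 3 := by gcongr; linarith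
        _ = 8 := by norm_num
    have h₄ : z ^ 3 ≤ z ^ 2 := pow_le_pow_of_le_one hz hz1 (by norm_num)
    nlinarith [mul_le_mul_of_nonneg_left h₃ (sq_nonneg z), sq_nonneg (z ^ 2)]
  have h₂ : (1 + z ^ 3) ^ ((2 : ℝ) / 3) = ((1 + z ^ 3) ^ 2) ^ ((1 : ℝ) / 3) := by
    rw [← Real.rpow_natCast (1 + z ^ 3) 2, ← Real.rpow_mul (by positivity)]
    norm_num
  rw [h₂]
  refine (Real.rpow_le_rpow (by positivity) h₁ (by norm_num)).trans_eq ?_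
  rw [← Real.rpow_natCast, ← Real.rpow_mul (by positivity)]
  norm_num

/-- Saddle point estimate at the critical point of `(1 + z ^ 2) ^ n / z ^ (2 * k)`. -/
theorem mul_le_choose_mul_exp_of_critical {n k a b a' b' : ℕ} {ε F F' z : ℝ} (hk : 1 ≤ k)
    (hkn : 2 * k ≤ n) (hz : 0 < z) (hzk : z ^ 2 = k / ((n : ℝ) - k)) (hF' : 0 ≤ F')
    (hb : (b : ℝ) + b' ≤ (1 - ε) * n) (hε : 0 ≤ ε)
    (h : F * z ^ k ≤ (1 + z) ^ a * ((1 + z ^ 2) ^ b *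
      (1 + z ^ 3) ^ (((n : ℝ) - a - 2 * b) / 3)))
    (h' : F' * z ^ k ≤ (1 + z) ^ a' * ((1 + z ^ 2) ^ b' *
      (1 + z ^ 3) ^ (((n : ℝ) - a' - 2 * b') / 3))) :
    F * F' ≤ n.choose k *
      (Real.exp 2 * √k * Real.exp (((a : ℝ) + a') * z - ε / 24 * k)) := by
  obtain ⟨j, rfl⟩ := Nat.exists_eq_add_of_le (show k ≤ n by omega)
  have hj : 1 ≤ j := by omega
  have hkj : k ≤ j := by omega
  have hk' : (0 : ℝ) < k := by exact_mod_cast hk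
  have hj' : (0 : ℝ) < j := by exact_mod_cast hj
  have hkj' : (k : ℝ) ≤ j := by exact_mod_cast hkj
  push_cast at *
  rw [add_sub_cancel_left] at hzk
  have hz1 : z ≤ 1 := by
    have : z ^ 2 ≤ 1 := by rw [hzk]; exact div_le_one_of_le₀ hkj' hj'.le
    nlinarith
  set n : ℝ := k + j with hn
  have hprod := mul_le_mul h h' (by positivity) (by positivity)
  set S : ℝ := b + b' with hS
  have hw : 0 < 1 + z ^ 3 := by positivity
  have hw1 : 1 ≤ 1 + z ^ 3 := by have := pow_pos hz 3; linarith
  have hv : 0 < 1 + z ^ 2 := by positivity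
  have hnS : ε * n ≤ n - S := by linarith
  have hn0 : 0 < n := by positivity
  have hcub : (1 + z ^ 3) ^ (((n : ℝ) - a - 2 * b) / 3) * (1 + z ^ 3) ^ (((n : ℝ) - a' - 2 * b') / 3)
      ≤ (1 + z ^ 2) ^ (n - S) * Real.exp (-(ε / 24 * k)) := by
    calc _ = (1 + z ^ 3) ^ (((n : ℝ) - a - 2 * b) / 3 + ((n : ℝ) - a' - 2 * b') / 3) :=
          (Real.rpow_add hw _ _).symm
      _ ≤ (1 + z ^ 3) ^ (2 / 3 * (n - S)) := by
          apply Real.rpow_le_rpow_of_exponent_le hw1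
          have : (0 : ℝ) ≤ a := Nat.cast_nonneg a
          have : (0 : ℝ) ≤ a' := Nat.cast_nonneg a'
          rw [hS]
          linarith
      _ = ((1 + z ^ 3) ^ ((2 : ℝ) / 3)) ^ (n - S) := Real.rpow_mul hw.le _ _
      _ ≤ ((1 + z ^ 2) * Real.exp (-(z ^ 2 / 24))) ^ (n - S) := by
          apply Real.rpow_le_rpow (by positivity) (one_add_cube_rpow_le hz.le hz1)
          nlinarith
      _ = (1 + z ^ 2) ^ (n - S) * Real.exp (-(z ^ 2 / 24) * (n - S)) := by
          rw [Real.mul_rpow hv.le (Real.exp_pos _).le, ← Real.exp_mul]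
      _ ≤ _ := by
          gcongr
          have h₁ : (k : ℝ) ≤ z ^ 2 * n := by
            rw [hzk, hn, div_mul_eq_mul_div, le_div_iff₀ hj']
            nlinarith
          have h₂ := mul_le_mul_of_nonneg_left hnS (sq_nonneg z)
          nlinarith
  have hlin : (1 + z) ^ a * (1 + z) ^ a' ≤ Real.exp (((a : ℝ) + a') * z) := by
    rw [← pow_add]
    calc (1 + z) ^ (a + a') ≤ Real.exp z ^ (a + a') := by
          gcongr
          linarith [Real.add_one_le_exp z]
      _ = _ := by rw [← Real.exp_nat_mul]; push_cast; rfl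
  have hquad : (1 + z ^ 2) ^ b * (1 + z ^ 2) ^ b' * (1 + z ^ 2) ^ (n - S) =
      (1 + z ^ 2) ^ (k + j) := by
    rw [← pow_add, ← Real.rpow_natCast (1 + z ^ 2), ← Real.rpow_natCast (1 + z ^ 2),
      ← Real.rpow_add hv]
    congr 1
    push_cast
    rw [← hS, ← hn]
    ring
  have hmain : F * F' * (z ^ 2) ^ k ≤
      (1 + z ^ 2) ^ (k + j) * Real.exp (((a : ℝ) + a') * z - ε / 24 * k) := by
    calc F * F' * (z ^ 2) ^ k = F * z ^ k * (F' * z ^ k) := by ring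
      _ ≤ _ := hprod
      _ = ((1 + z) ^ a * (1 + z) ^ a') * ((1 + z ^ 2) ^ b * (1 + z ^ 2) ^ b') *
          ((1 + z ^ 3) ^ (((n : ℝ) - a - 2 * b) / 3) *
            (1 + z ^ 3) ^ (((n : ℝ) - a' - 2 * b') / 3)) := by ring
      _ ≤ Real.exp (((a : ℝ) + a') * z) * ((1 + z ^ 2) ^ b * (1 + z ^ 2) ^ b') *
          ((1 + z ^ 2) ^ (n - S) * Real.exp (-(ε / 24 * k))) := by gcongr
      _ = ((1 + z ^ 2) ^ b * (1 + z ^ 2) ^ b' * (1 + z ^ 2) ^ (n - S)) *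
          (Real.exp (((a : ℝ) + a') * z) * Real.exp (-(ε / 24 * k))) := by ring
      _ = _ := by rw [hquad, ← Real.exp_add, sub_eq_add_neg]
  have hbin : (1 + z ^ 2) ^ (k + j) ≤
      (k + j).choose k * (Real.exp 2 * √k) * (z ^ 2) ^ k := by
    have h₁ : 1 + z ^ 2 = n / j := by rw [hzk, hn]; field_simp; ring
    rw [h₁, hzk, div_pow, div_pow, div_le_iff₀ (by positivity)]
    refine (add_pow_le_choose_mul hk hj).trans_eq ?_
    rw [pow_add]
    field_simp
  refine le_of_mul_le_mul_right ?_ (show 0 < (z ^ 2) ^ k by positivity)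
  refine hmain.trans ((mul_le_mul_of_nonneg_right hbin (Real.exp_pos _).le).trans_eq ?_)
  ring

theorem div_pow_le_choose {n k : ℕ} (hk : 1 ≤ k) (hkn : k ≤ n) :
    ((n : ℝ) / k) ^ k ≤ n.choose k := by
  induction k, hk using Nat.le_induction generalizing n with
  | base => simp
  | succ k hk ih =>
    obtain ⟨m, rfl⟩ := Nat.exists_eq_add_of_le' (show 1 ≤ n by omega)
    have hm := ih (show k ≤ m by omega)
    have hk' : (0 : ℝ) < k := by exact_mod_cast hk
    have h₁ : ((m + 1).choose (k + 1) : ℝ) = (m + 1 : ℝ) / (k + 1) * m.choose k := by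
      have := Nat.add_one_mul_choose_eq m k
      rw [div_mul_eq_mul_div, eq_div_iff (by positivity)]
      exact_mod_cast this.symm
    rw [h₁, pow_succ']
    push_cast
    gcongr
    refine le_trans ?_ hm
    gcongr ?_ ^ k
    have : (k : ℝ) ≤ m := by exact_mod_cast (show k ≤ m by omega)
    rw [div_le_div_iff₀ (by positivity) hk']
    nlinarith

/-- Estimate with `x = 1 / M`, where `M ≥ 1 / x` controls each of the three summands. -/
theorem mul_le_pow_mul_exp {k : ℕ} {F F' M M' A A' : ℝ} {Φ Φ' : ℝ → ℝ} (hF' : 0 ≤ F')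
    (hM : 0 < M) (hM' : 0 < M') (h : F * (1 / M) ^ k ≤ Real.exp (Φ (1 / M)))
    (h' : F' * (1 / M') ^ k ≤ Real.exp (Φ' (1 / M')))
    (hA : Φ (1 / M) ≤ A) (hA' : Φ' (1 / M') ≤ A') :
    F * F' ≤ (M * M') ^ k * Real.exp (A + A') := by
  have h₁ : F ≤ M ^ k * Real.exp A := by
    have := h.trans (Real.exp_le_exp.2 hA)
    rwa [one_div, inv_pow, ← div_eq_mul_inv, div_le_iff₀ (by positivity), mul_comm] at this
  have h₂ : F' ≤ M' ^ k * Real.exp A' := by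
    have := h'.trans (Real.exp_le_exp.2 hA')
    rwa [one_div, inv_pow, ← div_eq_mul_inv, div_le_iff₀ (by positivity), mul_comm] at this
  refine (mul_le_mul h₁ h₂ hF' (by positivity)).trans_eq ?_
  rw [Real.exp_add]
  ring

/-- The estimate when few points lie in `2`-cycles of both permutations and `k = s ^ 6` is small
compared to `n = m ^ 6`. -/
theorem mul_le_choose_mul_exp_of_sparse {n k : ℕ} {a a' u u' m s D θ F F' : ℝ} (hk : 1 ≤ k)
    (hkn : k ≤ n) (ha : 0 ≤ a) (ha' : 0 ≤ a') (hu : 0 ≤ u) (hu' : 0 ≤ u') (hm : 0 < m)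
    (hs : 1 ≤ s) (hD : 1 ≤ D) (hθ : θ = Real.exp (-5) / 9) (hF' : 0 ≤ F') (hkk : s ^ 6 = k)
    (hnn : m ^ 6 = n)
    (ham : a ≤ D * m ^ 4) (ham' : a' ≤ D * m ^ 4) (haa : a * a' ≤ D * m ^ 6)
    (hau : a * u' ≤ D * m ^ 6) (hau' : a' * u ≤ D * m ^ 6) (huu : u * u' ≤ θ * m ^ 6)
    (hum : u ≤ m ^ 3) (hum' : u' ≤ m ^ 3) (hsm : s ≤ θ * m)
    (h : ∀ x : ℝ, 0 < x → F * x ^ k ≤ Real.exp (a * x + u ^ 2 * x ^ 2 + n / 3 * x ^ 3))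
    (h' : ∀ x : ℝ, 0 < x → F' * x ^ k ≤ Real.exp (a' * x + u' ^ 2 * x ^ 2 + n / 3 * x ^ 3)) :
    F * F' ≤ n.choose k * Real.exp (2 * D / θ * s ^ 4 - k) := by
  have hs0 : 0 < s := by linarith
  have hD0 : 0 < D := by linarith
  have hθ0 : 0 < θ := by rw [hθ]; positivity
  have hθ1 : θ ≤ 1 := by
    rw [hθ]
    have : Real.exp (-5) ≤ 1 := Real.exp_le_one_iff.2 (by norm_num)
    linarith
  obtain ⟨r, hr⟩ : ∃ r, r = 1 / s := ⟨_, rfl⟩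
  have hr0 : 0 < r := by rw [hr]; positivity
  have hr1 : r ≤ 1 := by rw [hr]; exact div_le_one_of_le₀ hs hs0.le
  have hrs : r * s = 1 := by rw [hr]; field_simp
  have hmr : 1 ≤ θ * (m * r) := by nlinarith
  have hmr0 : 0 < m * r := by positivity
  set T := (m * r) ^ 6 with hT
  have hT0 : 0 < T := by positivity
  have h₁ : ∀ c c' : ℝ, 0 ≤ c → 0 ≤ c' → c * c' ≤ D * m ^ 6 →
      (θ / D * c * r ^ 4) * (θ / D * c' * r ^ 4) ≤ θ * T := by
    intro c c' hc hc' hcc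
    calc _ = (θ / D) ^ 2 * r ^ 8 * (c * c') := by ring
      _ ≤ (θ / D) ^ 2 * r ^ 8 * (D * m ^ 6) := by gcongr
      _ = θ * T * (θ * (1 / D) * r ^ 2) := by rw [hT]; field_simp
      _ ≤ θ * T * (1 * 1 * 1 ^ 2) := by
        gcongr
        exact div_le_one_of_le₀ hD hD0.le
      _ = θ * T := by ring
  have h₂ : ∀ c c' : ℝ, c * c' ≤ D * m ^ 6 →
      (θ / D * c * r ^ 4) * (c' * r ^ 3) ≤ θ * T := by
    intro c c' hcc
    calc _ = (θ / D) * r ^ 7 * (c * c') := by ring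
      _ ≤ (θ / D) * r ^ 7 * (D * m ^ 6) := by gcongr
      _ = θ * T * r := by rw [hT]; field_simp
      _ ≤ θ * T * 1 := by gcongr
      _ = θ * T := by ring
  have h₃ : ∀ c : ℝ, c ≤ D * m ^ 4 → (θ / D * c * r ^ 4) * (m ^ 2 * r ^ 2) ≤ θ * T := by
    intro c hc
    calc _ = (θ / D) * r ^ 6 * m ^ 2 * c := by ring
      _ ≤ (θ / D) * r ^ 6 * m ^ 2 * (D * m ^ 4) := by gcongr
      _ = θ * T := by rw [hT]; field_simp
  have h₄ : (u * r ^ 3) * (u' * r ^ 3) ≤ θ * T := by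
    calc _ = (u * u') * r ^ 6 := by ring
      _ ≤ (θ * m ^ 6) * r ^ 6 := by gcongr
      _ = θ * T := by rw [hT]; ring
  have h₅ : ∀ c : ℝ, c ≤ m ^ 3 → (c * r ^ 3) * (m ^ 2 * r ^ 2) ≤ θ * T := by
    intro c hc
    calc _ ≤ (m ^ 3 * r ^ 3) * (m ^ 2 * r ^ 2) := by gcongr
      _ = (m * r) ^ 5 * 1 := by ring
      _ ≤ (m * r) ^ 5 * (θ * (m * r)) := by gcongr
      _ = θ * T := by rw [hT]; ring
  have h₆ : (m ^ 2 * r ^ 2) * (m ^ 2 * r ^ 2) ≤ θ * T := by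
    have h1 : 1 ≤ m * r := by nlinarith
    calc _ = (m * r) ^ 4 * 1 * 1 := by ring
      _ ≤ (m * r) ^ 4 * (m * r) * (θ * (m * r)) := by gcongr
      _ = θ * T := by rw [hT]; ring
  have hbound : ∀ c v : ℝ, 0 ≤ c → 0 ≤ v →
      c * (1 / (θ / D * c * r ^ 4 + v * r ^ 3 + m ^ 2 * r ^ 2)) +
        v ^ 2 * (1 / (θ / D * c * r ^ 4 + v * r ^ 3 + m ^ 2 * r ^ 2)) ^ 2 +
        n / 3 * (1 / (θ / D * c * r ^ 4 + v * r ^ 3 + m ^ 2 * r ^ 2)) ^ 3 ≤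
      D / θ * s ^ 4 + 2 * k := by
    intro c v hc hv
    set N := θ / D * c * r ^ 4 + v * r ^ 3 + m ^ 2 * r ^ 2 with hN
    have hp₁ : 0 ≤ θ / D * c * r ^ 4 := by positivity
    have hp₂ : 0 ≤ v * r ^ 3 := by positivity
    have hp₃ : 0 < m ^ 2 * r ^ 2 := by positivity
    have hN0 : 0 < N := by rw [hN]; positivity
    have e₁ : c * (1 / N) ≤ D / θ * s ^ 4 := by
      rw [mul_one_div, div_le_iff₀ hN0]
      calc c = D / θ * s ^ 4 * (θ / D * c * r ^ 4) := by rw [hr]; field_simp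
        _ ≤ _ := by gcongr; linarith
    have e₂ : v * (1 / N) ≤ s ^ 3 := by
      rw [mul_one_div, div_le_iff₀ hN0]
      calc v = s ^ 3 * (v * r ^ 3) := by rw [hr]; field_simp
        _ ≤ _ := by gcongr; linarith
    have e₃ : m ^ 2 * (1 / N) ≤ s ^ 2 := by
      rw [mul_one_div, div_le_iff₀ hN0]
      calc m ^ 2 = s ^ 2 * (m ^ 2 * r ^ 2) := by rw [hr]; field_simp
        _ ≤ _ := by gcongr; linarith
    have e₂' : v ^ 2 * (1 / N) ^ 2 ≤ k := by
      calc _ = (v * (1 / N)) ^ 2 := by ring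
        _ ≤ (s ^ 3) ^ 2 := by gcongr
        _ = k := by rw [← hkk]; ring
    have e₃' : n / 3 * (1 / N) ^ 3 ≤ k := by
      calc _ = (m ^ 2 * (1 / N)) ^ 3 / 3 := by rw [← hnn]; ring
        _ ≤ (s ^ 2) ^ 3 / 3 := by gcongr
        _ = s ^ 6 / 3 := by ring
        _ ≤ k := by rw [← hkk]; linarith [pow_pos hs0 6]
    linarith
  have hM0 : 0 < θ / D * a * r ^ 4 + u * r ^ 3 + m ^ 2 * r ^ 2 := by positivity
  have hM0' : 0 < θ / D * a' * r ^ 4 + u' * r ^ 3 + m ^ 2 * r ^ 2 := by positivity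
  have hfin := mul_le_pow_mul_exp (Φ := fun x => a * x + u ^ 2 * x ^ 2 + n / 3 * x ^ 3)
    (Φ' := fun x => a' * x + u' ^ 2 * x ^ 2 + n / 3 * x ^ 3) hF' hM0 hM0'
    (h _ (by positivity)) (h' _ (by positivity)) (hbound a u ha hu) (hbound a' u' ha' hu')
  have hprod : (θ / D * a * r ^ 4 + u * r ^ 3 + m ^ 2 * r ^ 2) *
      (θ / D * a' * r ^ 4 + u' * r ^ 3 + m ^ 2 * r ^ 2) ≤ Real.exp (-5) * (n / k) := by
    have hTk : T = n / k := by rw [hT, hr, ← hnn, ← hkk]; field_simp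
    have hθ9 : Real.exp (-5) = 9 * θ := by rw [hθ]; ring
    rw [← hTk, hθ9]
    have := h₁ a a' ha ha' haa
    have := h₂ a u' hau
    have := h₂ a' u hau'
    have := h₃ a ham
    have := h₃ a' ham'
    have := h₅ u hum
    have := h₅ u' hum'
    linarith
  refine hfin.trans ?_
  calc _ ≤ (Real.exp (-5) * (n / k)) ^ k *
        Real.exp (D / θ * s ^ 4 + 2 * k + (D / θ * s ^ 4 + 2 * k)) := by gcongr
    _ = ((n : ℝ) / k) ^ k * (Real.exp (-5) ^ k *
        Real.exp (D / θ * s ^ 4 + 2 * k + (D / θ * s ^ 4 + 2 * k))) := by rw [mul_pow]; ring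
    _ = ((n : ℝ) / k) ^ k * Real.exp (2 * D / θ * s ^ 4 - k) := by
      rw [← Real.exp_nat_mul, ← Real.exp_add]
      congr 2
      ring
    _ ≤ _ := by
      gcongr
      exact div_pow_le_choose hk hkn

theorem summable_exp_mul_rpow_sub {C δ : ℝ} (hC : 0 ≤ C) (hδ : 0 < δ) :
    Summable fun k : ℕ => Real.exp (C * (k : ℝ) ^ ((2 : ℝ) / 3) - δ * k) := by
  have hgeo : Summable fun k : ℕ =>
      Real.exp (C * (2 * C / δ) ^ 2) * Real.exp (-(δ / 2)) ^ k :=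
    (summable_geometric_of_lt_one (Real.exp_pos _).le
      (Real.exp_lt_one_iff.2 (by linarith))).mul_left _
  refine hgeo.of_nonneg_of_le (fun k => (Real.exp_pos _).le) fun k => ?_
  rw [← Real.exp_nat_mul, ← Real.exp_add, Real.exp_le_exp]
  set t := (k : ℝ) ^ ((1 : ℝ) / 3) with ht
  have ht0 : 0 ≤ t := by positivity
  have h2 : (k : ℝ) ^ ((2 : ℝ) / 3) = t ^ 2 := by
    rw [ht, ← Real.rpow_natCast, ← Real.rpow_mul (Nat.cast_nonneg k)]; norm_num
  have h3 : (k : ℝ) = t ^ 3 := by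
    rw [ht, ← Real.rpow_natCast, ← Real.rpow_mul (Nat.cast_nonneg k)]; norm_num
  rw [h2, h3]
  rcases le_total t (2 * C / δ) with h | h
  · have : C * t ^ 2 ≤ C * (2 * C / δ) ^ 2 := by gcongr
    have : 0 ≤ δ * t ^ 3 := by positivity
    linarith
  · rw [div_le_iff₀ hδ] at h
    have : t ^ 2 * (2 * C) ≤ t ^ 2 * (t * δ) := by gcongr
    have : 0 ≤ C * (2 * C / δ) ^ 2 := by positivity
    nlinarith

theorem card_invariantSets_mul_pow_le_exp {n : ℕ} (σ : Perm (Fin n)) (k : ℕ) {x : ℝ}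
    (hx : 0 < x) :
    #(invariantSets σ k) * x ^ k ≤
      Real.exp (cycleCount σ 1 * x + √(cycleCount σ 2) ^ 2 * x ^ 2 + n / 3 * x ^ 3) := by
  refine (card_invariantSets_mul_pow_le_cycleCount σ k hx.le).trans ?_
  have hexp : ∀ (y : ℝ) (m : ℕ), 0 ≤ y → (1 + y) ^ m ≤ Real.exp (m * y) := by
    intro y m hy
    rw [Real.exp_nat_mul]
    gcongr
    linarith [Real.add_one_le_exp y]
  have hcube : (1 + x ^ 3) ^ (((n : ℝ) - cycleCount σ 1 - 2 * cycleCount σ 2) / 3) ≤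
      Real.exp (n / 3 * x ^ 3) := by
    have h₁ : (1 : ℝ) ≤ 1 + x ^ 3 := by linarith [pow_pos hx 3]
    calc _ ≤ (1 + x ^ 3) ^ ((n : ℝ) / 3) := by
          apply Real.rpow_le_rpow_of_exponent_le h₁
          have h₂ : (0 : ℝ) ≤ cycleCount σ 1 := Nat.cast_nonneg _
          have h₃ : (0 : ℝ) ≤ cycleCount σ 2 := Nat.cast_nonneg _
          linarith
      _ ≤ Real.exp (x ^ 3) ^ ((n : ℝ) / 3) := by
          apply Real.rpow_le_rpow (by positivity) _ (by positivity)
          linarith [Real.add_one_le_exp (x ^ 3)]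
      _ = _ := by rw [← Real.exp_mul, mul_comm]
  rw [Real.sq_sqrt (Nat.cast_nonneg _), Real.exp_add, Real.exp_add, mul_assoc]
  gcongr
  · exact hexp x _ hx.le
  · exact hexp (x ^ 2) _ (by positivity)

/-- The crude estimate, sharp up to a factor depending only on `k`. -/
theorem card_invariantSets_mul_card_le {n k : ℕ} (hk : 1 ≤ k) (hkn : k ≤ n)
    (σ σ' : Perm (Fin n)) :
    (#(invariantSets σ k) : ℝ) * #(invariantSets σ' k) / n.choose k ≤ Real.exp 6 *
      (((cycleCount σ 1 + √(cycleCount σ 2) + (n : ℝ) ^ ((1 : ℝ) / 3)) *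
        (cycleCount σ' 1 + √(cycleCount σ' 2) + (n : ℝ) ^ ((1 : ℝ) / 3))) / n * k) ^ k := by
  have hn : (0 : ℝ) < n := by exact_mod_cast (by omega : 0 < n)
  have hk' : (0 : ℝ) < k := by exact_mod_cast hk
  set t := (n : ℝ) ^ ((1 : ℝ) / 3) with ht
  have ht0 : 0 < t := by positivity
  have ht3 : t ^ 3 = n := by
    rw [ht, ← Real.rpow_natCast, ← Real.rpow_mul hn.le]; norm_num
  have hbound : ∀ c v : ℝ, 0 ≤ c → 0 ≤ v →
      c * (1 / (c + v + t)) + v ^ 2 * (1 / (c + v + t)) ^ 2 + n / 3 * (1 / (c + v + t)) ^ 3 ≤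
        3 := by
    intro c v hc hv
    have hN : 0 < c + v + t := by positivity
    have e₁ : c * (1 / (c + v + t)) ≤ 1 := by
      rw [mul_one_div, div_le_one hN]; linarith
    have e₂ : v ^ 2 * (1 / (c + v + t)) ^ 2 ≤ 1 := by
      rw [← mul_pow, mul_one_div]
      exact pow_le_one₀ (by positivity) (by rw [div_le_one hN]; linarith)
    have e₃ : n / 3 * (1 / (c + v + t)) ^ 3 ≤ 1 := by
      have : (t / (c + v + t)) ^ 3 ≤ 1 :=
        pow_le_one₀ (by positivity) (by rw [div_le_one hN]; linarith)
      calc n / 3 * (1 / (c + v + t)) ^ 3 = (t / (c + v + t)) ^ 3 / 3 := by rw [← ht3]; ring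
        _ ≤ 1 := by linarith
    linarith
  have hM : ∀ τ : Perm (Fin n), 0 < (cycleCount τ 1 : ℝ) + √(cycleCount τ 2) + t := fun τ => by
    positivity
  have h := mul_le_pow_mul_exp
    (Φ := fun x => cycleCount σ 1 * x + √(cycleCount σ 2) ^ 2 * x ^ 2 + n / 3 * x ^ 3)
    (Φ' := fun x => cycleCount σ' 1 * x + √(cycleCount σ' 2) ^ 2 * x ^ 2 + n / 3 * x ^ 3)
    (Nat.cast_nonneg _) (hM σ) (hM σ')
    (card_invariantSets_mul_pow_le_exp σ k (by have := hM σ; positivity))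
    (card_invariantSets_mul_pow_le_exp σ' k (by have := hM σ'; positivity))
    (hbound _ _ (Nat.cast_nonneg _) (Real.sqrt_nonneg _))
    (hbound _ _ (Nat.cast_nonneg _) (Real.sqrt_nonneg _))
  have hch : (0 : ℝ) < n.choose k := by exact_mod_cast Nat.choose_pos hkn
  rw [div_le_iff₀ hch]
  refine h.trans ?_
  norm_num only
  set Q := ((cycleCount σ 1 : ℝ) + √(cycleCount σ 2) + t) *
    (cycleCount σ' 1 + √(cycleCount σ' 2) + t) with hQ
  have hQ0 : 0 ≤ Q := (mul_pos (hM σ) (hM σ')).le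
  calc Q ^ k * Real.exp 6 = Real.exp 6 * (Q / n * k) ^ k * ((n : ℝ) / k) ^ k := by
        rw [mul_assoc, ← mul_pow, mul_comm]
        congr 2
        field_simp
    _ ≤ _ := by
        gcongr
        exact div_pow_le_choose hk hkn

/-- A summable bound for the expected numbers of common invariant `k`-sets. -/
theorem exists_summable_bound {D ε : ℝ} (hD : 1 ≤ D) (hε : 0 < ε) :
    ∃ G : ℕ → ℝ, Summable G ∧ (∀ k, 0 ≤ G k) ∧
      ∀ (n k : ℕ) (σ σ' : Perm (Fin n)), 1 ≤ k → 2 * k ≤ n →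
      (cycleCount σ 1 : ℝ) + cycleCount σ' 1 ≤ D * (n : ℝ) ^ ((2 : ℝ) / 3) →
      ((cycleCount σ 1 : ℝ) + √(cycleCount σ 2)) * (cycleCount σ' 1 + √(cycleCount σ' 2)) ≤
        D * n →
      (cycleCount σ 2 : ℝ) + cycleCount σ' 2 ≤ (1 - ε) * n →
      (#(invariantSets σ k) : ℝ) * #(invariantSets σ' k) / n.choose k ≤ G k := by
  obtain ⟨θ, hθ⟩ : ∃ θ, θ = Real.exp (-5) / 9 := ⟨_, rfl⟩
  have hθ0 : 0 < θ := by rw [hθ]; positivity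
  have hD0 : 0 < D := by linarith
  obtain ⟨C, hC⟩ : ∃ C, C = 4 * D / θ + 1 := ⟨_, rfl⟩
  have hC0 : 0 ≤ C := by rw [hC]; positivity
  obtain ⟨δ, hδ⟩ : ∃ δ, δ = min 1 (ε / 24) := ⟨_, rfl⟩
  have hδ0 : 0 < δ := by rw [hδ]; positivity
  have hδ1 : δ ≤ 1 := hδ ▸ min_le_left _ _
  have hδε : δ ≤ ε / 24 := hδ ▸ min_le_right _ _
  refine ⟨fun k => Real.exp 2 * Real.exp (C * (k : ℝ) ^ ((2 : ℝ) / 3) - δ * k),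
    (summable_exp_mul_rpow_sub hC0 hδ0).mul_left _, fun k => by positivity, ?_⟩
  intro n k σ σ' hk hkn h₁ h₂ h₃
  have hn : (0 : ℝ) < n := by exact_mod_cast (by omega : 0 < n)
  have hk1 : (1 : ℝ) ≤ k := by exact_mod_cast hk
  have hk0 : (0 : ℝ) < k := by linarith
  have hkn' : 2 * (k : ℝ) ≤ n := by exact_mod_cast hkn
  have hch : (0 : ℝ) < n.choose k := by exact_mod_cast Nat.choose_pos (by omega : k ≤ n)
  rw [div_le_iff₀' hch]
  obtain ⟨s, hs⟩ : ∃ s, s = (k : ℝ) ^ ((1 : ℝ) / 6) := ⟨_, rfl⟩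
  obtain ⟨m, hm⟩ : ∃ m, m = (n : ℝ) ^ ((1 : ℝ) / 6) := ⟨_, rfl⟩
  have hs1 : 1 ≤ s := hs ▸ Real.one_le_rpow hk1 (by norm_num)
  have hs0 : 0 < s := by linarith
  have hm0 : 0 < m := by rw [hm]; positivity
  have hs6 : s ^ 6 = k := by
    rw [hs, ← Real.rpow_natCast, ← Real.rpow_mul hk0.le]; norm_num
  have hs4 : (k : ℝ) ^ ((2 : ℝ) / 3) = s ^ 4 := by
    rw [hs, ← Real.rpow_natCast, ← Real.rpow_mul hk0.le]; norm_num
  have hm6 : m ^ 6 = n := by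
    rw [hm, ← Real.rpow_natCast, ← Real.rpow_mul hn.le]; norm_num
  have hm4 : (n : ℝ) ^ ((2 : ℝ) / 3) = m ^ 4 := by
    rw [hm, ← Real.rpow_natCast, ← Real.rpow_mul hn.le]; norm_num
  rw [hm4] at h₁
  rw [← hm6] at h₂
  beta_reduce
  rw [hs4]
  have hu : ∀ τ : Perm (Fin n), √(cycleCount τ 2) ≤ m ^ 3 := by
    intro τ
    rw [Real.sqrt_le_left (by positivity), ← pow_mul, hm6]
    exact_mod_cast (by have := cycleCount_one_add_two_mul_le τ; omega)
  have hu₁ := hu σ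
  have hu₂ := hu σ'
  have hv₁ := Real.sqrt_nonneg (cycleCount σ 2)
  have hv₂ := Real.sqrt_nonneg (cycleCount σ' 2)
  have ha₁ : (0 : ℝ) ≤ cycleCount σ 1 := Nat.cast_nonneg _
  have ha₂ : (0 : ℝ) ≤ cycleCount σ' 1 := Nat.cast_nonneg _
  have hexp₁ := fun x hx => card_invariantSets_mul_pow_le_exp σ k (x := x) hx
  have hexp₂ := fun x hx => card_invariantSets_mul_pow_le_exp σ' k (x := x) hx
  obtain ⟨z, hz⟩ : ∃ z, z = √(k / ((n : ℝ) - k)) := ⟨_, rfl⟩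
  have hnk : (0 : ℝ) < n - k := by linarith
  have hz2 : z ^ 2 = k / ((n : ℝ) - k) := by rw [hz, Real.sq_sqrt (by positivity)]
  have hz0 : 0 < z := by rw [hz]; positivity
  have hzm : z * m ^ 3 ≤ 2 * s ^ 3 := by
    refine le_of_sq_le_sq ?_ (by positivity)
    have e : (z * m ^ 3) ^ 2 = k / ((n : ℝ) - k) * n := by rw [← hz2, ← hm6]; ring
    have e' : (2 * s ^ 3) ^ 2 = 4 * k := by rw [← hs6]; ring
    rw [e, e', div_mul_eq_mul_div, div_le_iff₀ hnk]
    nlinarith only [hkn', hk0]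
  have hsharp₁ := card_invariantSets_mul_pow_le_cycleCount σ k hz0.le
  have hsharp₂ := card_invariantSets_mul_pow_le_cycleCount σ' k hz0.le
  have hcrit := mul_le_choose_mul_exp_of_critical hk hkn hz0 hz2 (Nat.cast_nonneg _) h₃ hε.le
    hsharp₁ hsharp₂
  generalize √(cycleCount σ 2 : ℝ) = u at *
  generalize √(cycleCount σ' 2 : ℝ) = u' at *
  generalize (cycleCount σ 1 : ℝ) = a at *
  generalize (cycleCount σ' 1 : ℝ) = a' at *
  have p₁ := mul_nonneg ha₁ ha₂
  have p₂ := mul_nonneg ha₁ hv₂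
  have p₃ := mul_nonneg ha₂ hv₁
  have p₄ := mul_nonneg hv₁ hv₂
  have hau : a * u' ≤ D * m ^ 6 := by linarith only [h₂, p₁, p₂, p₃, p₄]
  have hau' : a' * u ≤ D * m ^ 6 := by linarith only [h₂, p₁, p₂, p₃, p₄]
  have haa : a * a' ≤ D * m ^ 6 := by linarith only [h₂, p₁, p₂, p₃, p₄]
  have hlinear : (a + a') * z ≤ 4 * D / θ * s ^ 4 →
      (#(invariantSets σ k) : ℝ) * #(invariantSets σ' k) ≤
        n.choose k * (Real.exp 2 * Real.exp (C * s ^ 4 - δ * k)) := by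
    intro hlin
    refine hcrit.trans ?_
    rw [mul_assoc (Real.exp 2)]
    gcongr
    have hsqrt : √(k : ℝ) = s ^ 3 := by
      rw [← hs6, show s ^ 6 = (s ^ 3) ^ 2 by ring, Real.sqrt_sq (by positivity)]
    have : √(k : ℝ) ≤ Real.exp (s ^ 4) := by
      rw [hsqrt]
      have : s ^ 3 ≤ s ^ 4 := pow_le_pow_right₀ hs1 (by norm_num)
      linarith [Real.add_one_le_exp (s ^ 4)]
    calc _ ≤ Real.exp (s ^ 4) * Real.exp ((a + a') * z - ε / 24 * k) := by gcongr
      _ = Real.exp (s ^ 4 + ((a + a') * z - ε / 24 * k)) := (Real.exp_add _ _).symm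
      _ ≤ _ := by
        gcongr
        rw [hC]
        have : δ * k ≤ ε / 24 * k := by gcongr
        linarith only [this, hlin]
  by_cases huu : u * u' ≤ θ * m ^ 6
  · by_cases hsm : s ≤ θ * m
    · refine (mul_le_choose_mul_exp_of_sparse hk (by omega) ha₁ ha₂ hv₁ hv₂ hm0 hs1 hD hθ
        (Nat.cast_nonneg _) hs6 hm6 (by linarith) (by linarith) haa hau hau' huu hu₁ hu₂ hsm
        hexp₁ hexp₂).trans ?_
      gcongr
      rw [← Real.exp_add]
      gcongr
      rw [hC]
      have : 0 < s ^ 4 := by positivity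
      have : 2 * D / θ * s ^ 4 ≤ 4 * D / θ * s ^ 4 := by gcongr; norm_num
      have : δ * k ≤ 1 * k := by gcongr
      linarith
    · apply hlinear
      push Not at hsm
      calc (a + a') * z ≤ D * m ^ 4 * z := by gcongr
        _ = D * (z * m ^ 3) * m := by ring
        _ ≤ D * (2 * s ^ 3) * (s / θ) := by
          gcongr
          rw [le_div_iff₀ hθ0]
          linarith
        _ = 2 * D / θ * s ^ 4 := by ring
        _ ≤ _ := by gcongr; norm_num
  · apply hlinear
    push Not at huu
    have hsmall : ∀ c v w : ℝ, 0 ≤ c → 0 ≤ w → v ≤ m ^ 3 → θ * m ^ 6 < v * w →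
        c * w ≤ D * m ^ 6 → c ≤ D / θ * m ^ 3 := by
      intro c v w hc hw hv hvw hcw
      have hw' : θ * m ^ 3 ≤ w := by
        refine le_of_mul_le_mul_left ?_ (show 0 < m ^ 3 by positivity)
        calc m ^ 3 * (θ * m ^ 3) = θ * m ^ 6 := by ring
          _ ≤ v * w := hvw.le
          _ ≤ m ^ 3 * w := by gcongr
      refine le_of_mul_le_mul_right ?_ (show 0 < θ * m ^ 3 by positivity)
      calc c * (θ * m ^ 3) ≤ c * w := by gcongr
        _ ≤ _ := hcw
        _ = _ := by field_simp
    have hc₁ := hsmall a u u' ha₁ hv₂ hu₁ huu hau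
    have hc₂ := hsmall a' u' u ha₂ hv₁ hu₂ (by linarith) hau'
    calc (a + a') * z ≤ (D / θ * m ^ 3 + D / θ * m ^ 3) * z := by gcongr
      _ = 2 * D / θ * (z * m ^ 3) := by ring
      _ ≤ 2 * D / θ * (2 * s ^ 3) := by gcongr
      _ = 4 * D / θ * s ^ 3 := by ring
      _ ≤ _ := by gcongr; norm_num

theorem exists_summable_eventually_bound (π π' : (n : ℕ) → Perm (Fin n)) {D ε : ℝ}
    (hD : 1 ≤ D) (hε : 0 < ε)
    (h₁ : ∀ᶠ n : ℕ in atTop, (cycleCount (π n) 1 : ℝ) + cycleCount (π' n) 1 ≤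
      D * (n : ℝ) ^ ((2 : ℝ) / 3))
    (h₂ : ∀ᶠ n : ℕ in atTop, ((cycleCount (π n) 1 : ℝ) + √(cycleCount (π n) 2)) *
      (cycleCount (π' n) 1 + √(cycleCount (π' n) 2)) ≤ D * n)
    (h₃ : ∀ᶠ n : ℕ in atTop, (cycleCount (π n) 2 : ℝ) + cycleCount (π' n) 2 ≤ (1 - ε) * n) :
    ∃ G : ℕ → ℝ, Summable G ∧ (∀ k, 0 ≤ G k) ∧ ∀ᶠ n : ℕ in atTop, ∀ k, 1 ≤ k → 2 * k ≤ n →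
      (#(invariantSets (π n) k) : ℝ) * #(invariantSets (π' n) k) / n.choose k ≤ G k := by
  obtain ⟨G, hG, hG0, h⟩ := exists_summable_bound hD hε
  refine ⟨G, hG, hG0, ?_⟩
  filter_upwards [h₁, h₂, h₃] with n e₁ e₂ e₃ k hk hkn
  exact h n k _ _ hk hkn e₁ e₂ e₃

theorem exists_bound_of_eventually_le {f : ℕ → ℝ} {A : ℝ} (h : ∀ᶠ n in atTop, |f n| ≤ A) :
    ∃ B : ℝ, ∀ n, |f n| ≤ B := by
  obtain ⟨N, hN⟩ := eventually_atTop.1 h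
  have hsum : 0 ≤ ∑ i ∈ range N, |f i| := Finset.sum_nonneg fun i _ => abs_nonneg _
  refine ⟨|A| + ∑ i ∈ range N, |f i|, fun n => ?_⟩
  rcases lt_or_ge n N with hn | hn
  · have := Finset.single_le_sum (f := fun i => |f i|) (fun i _ => abs_nonneg _) (mem_range.2 hn)
    linarith [abs_nonneg A]
  · linarith [hN n hn, le_abs_self A]

theorem bounded_expectedSmallOrbits (π π' : (n : ℕ) → Perm (Fin n))
    (h₁ : (fun n => (cycleCount (π n) 1 : ℝ) + cycleCount (π' n) 1) =O[atTop]
      fun n => (n : ℝ) ^ ((2 : ℝ) / 3))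
    (h₂ : (fun n => ((cycleCount (π n) 1 : ℝ) + √(cycleCount (π n) 2)) *
      (cycleCount (π' n) 1 + √(cycleCount (π' n) 2))) =O[atTop] fun n => (n : ℝ))
    (h₃ : limsup (fun n => ((cycleCount (π n) 2 : ℝ) + cycleCount (π' n) 2) / n) atTop < 1) :
    ∃ B : ℝ, ∀ n, |expectedSmallOrbits n (π n) (π' n)| ≤ B := by
  obtain ⟨D₁, hD₁⟩ := h₁.bound
  obtain ⟨D₂, hD₂⟩ := h₂.bound
  obtain ⟨q, hq, hq1⟩ := exists_between h₃
  have hbdd : IsBoundedUnder (· ≤ ·) atTop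
      (fun n => ((cycleCount (π n) 2 : ℝ) + cycleCount (π' n) 2) / n) := by
    refine isBoundedUnder_of ⟨1, fun n => div_le_one_of_le₀ ?_ (Nat.cast_nonneg _)⟩
    have := cycleCount_one_add_two_mul_le (π n)
    have := cycleCount_one_add_two_mul_le (π' n)
    exact_mod_cast (by omega)
  have hq' := eventually_lt_of_limsup_lt hq hbdd
  obtain ⟨G, hG, hG0, h⟩ := exists_summable_eventually_bound π π'
    (D := max 1 (max D₁ D₂)) (ε := 1 - q) (le_max_left _ _) (by linarith)
    (by
      filter_upwards [hD₁] with n hn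
      rw [Real.norm_of_nonneg (by positivity), Real.norm_of_nonneg (by positivity)] at hn
      refine hn.trans ?_
      gcongr
      exact (le_max_left _ _).trans (le_max_right _ _))
    (by
      filter_upwards [hD₂] with n hn
      rw [Real.norm_of_nonneg (by positivity), Real.norm_of_nonneg (by positivity)] at hn
      refine hn.trans ?_
      gcongr
      exact (le_max_right _ _).trans (le_max_right _ _))
    (by
      filter_upwards [hq', eventually_gt_atTop 0] with n hn hn0
      rw [div_lt_iff₀ (by exact_mod_cast hn0)] at hn
      linarith)
  apply exists_bound_of_eventually_le (A := ∑' k, G k)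
  filter_upwards [h] with n hn
  rw [abs_of_nonneg (expectedSmallOrbits_nonneg _ _ _)]
  refine (expectedSmallOrbits_le _ _ _).trans (le_trans ?_
    (hG.sum_le_tsum (Icc 1 (n / 2)) fun k _ => hG0 k))
  refine Finset.sum_le_sum fun k hk => ?_
  rw [mem_Icc] at hk
  exact hn k hk.1 (by omega)

/-- The geometric mean controls the arithmetic mean away from its extreme value. -/
theorem add_le_of_mul_le {x y n : ℝ} (hx : 0 ≤ x) (hy : 0 ≤ y) (hxn : 2 * x ≤ n)
    (hyn : 2 * y ≤ n) (hxy : √x * √y ≤ 1 / 4 * n) : x + y ≤ (1 - 1 / 8) * n := by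
  have h : x * y ≤ n ^ 2 / 16 := by
    calc x * y = (√x * √y) ^ 2 := by rw [mul_pow, Real.sq_sqrt hx, Real.sq_sqrt hy]
      _ ≤ (1 / 4 * n) ^ 2 := by gcongr
      _ = n ^ 2 / 16 := by ring
  by_contra! hc
  nlinarith [mul_nonneg (sub_nonneg.2 hxn) (sub_nonneg.2 hyn)]

theorem isLittleO_crude_product (π π' : (n : ℕ) → Perm (Fin n))
    (h₁ : (fun n => (cycleCount (π n) 1 : ℝ) + cycleCount (π' n) 1) =o[atTop]
      fun n => (n : ℝ) ^ ((2 : ℝ) / 3))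
    (h₂ : (fun n => ((cycleCount (π n) 1 : ℝ) + √(cycleCount (π n) 2)) *
      (cycleCount (π' n) 1 + √(cycleCount (π' n) 2))) =o[atTop] fun n => (n : ℝ)) :
    (fun n : ℕ => (cycleCount (π n) 1 + √(cycleCount (π n) 2) + (n : ℝ) ^ ((1 : ℝ) / 3)) *
      (cycleCount (π' n) 1 + √(cycleCount (π' n) 2) + (n : ℝ) ^ ((1 : ℝ) / 3))) =o[atTop]
      fun n => (n : ℝ) := by
  have hpow : ∀ r : ℝ, r < 1 → (fun n : ℕ => (n : ℝ) ^ r) =o[atTop] fun n => (n : ℝ) := by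
    intro r hr
    refine (isLittleO_iff_tendsto' ?_).2 ?_
    · filter_upwards [eventually_gt_atTop 0] with n hn h0
      exact absurd h0 (by positivity)
    · refine ((tendsto_rpow_neg_atTop (sub_pos.2 hr)).comp
        tendsto_natCast_atTop_atTop).congr' ?_
      filter_upwards [eventually_gt_atTop 0] with n hn
      simp only [Function.comp_apply]
      rw [neg_sub, Real.rpow_sub_one (by positivity)]
  have hmul : ∀ n : ℕ, (n : ℝ) ^ ((1 : ℝ) / 3) * (n : ℝ) ^ ((2 : ℝ) / 3) = n := fun n => by
    rw [← Real.rpow_add_of_nonneg (Nat.cast_nonneg _) (by norm_num) (by norm_num)]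
    norm_num
  have h₃ : (fun n : ℕ => (n : ℝ) ^ ((1 : ℝ) / 3) *
      ((cycleCount (π n) 1 : ℝ) + cycleCount (π' n) 1)) =o[atTop] fun n => (n : ℝ) := by
    have := (isBigO_refl (fun n : ℕ => (n : ℝ) ^ ((1 : ℝ) / 3)) atTop).mul_isLittleO h₁
    simpa only [hmul] using this
  have h₄ : ∀ τ : (n : ℕ) → Perm (Fin n), (fun n : ℕ => (n : ℝ) ^ ((1 : ℝ) / 3) *
      √(cycleCount (τ n) 2)) =o[atTop] fun n => (n : ℝ) := by
    intro τ
    refine IsBigO.trans_isLittleO (IsBigO.of_bound 1 (Eventually.of_forall fun n => ?_))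
      (hpow (5 / 6) (by norm_num))
    rw [Real.norm_of_nonneg (by positivity), Real.norm_of_nonneg (by positivity), one_mul,
      show (5 / 6 : ℝ) = 1 / 3 + 1 / 2 by norm_num,
      Real.rpow_add_of_nonneg (Nat.cast_nonneg _) (by norm_num) (by norm_num),
      ← Real.sqrt_eq_rpow]
    gcongr
    have := cycleCount_one_add_two_mul_le (τ n)
    omega
  have h₅ := ((h₂.add h₃).add ((h₄ π).add (h₄ π'))).add (hpow (2 / 3) (by norm_num))
  refine h₅.congr_left fun n => ?_
  rw [show (2 / 3 : ℝ) = 1 / 3 + 1 / 3 by norm_num,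
    Real.rpow_add_of_nonneg (Nat.cast_nonneg _) (by norm_num) (by norm_num)]
  ring

theorem tendsto_expectedSmallOrbits (π π' : (n : ℕ) → Perm (Fin n))
    (h₁ : (fun n => (cycleCount (π n) 1 : ℝ) + cycleCount (π' n) 1) =o[atTop]
      fun n => (n : ℝ) ^ ((2 : ℝ) / 3))
    (h₂ : (fun n => ((cycleCount (π n) 1 : ℝ) + √(cycleCount (π n) 2)) *
      (cycleCount (π' n) 1 + √(cycleCount (π' n) 2))) =o[atTop] fun n => (n : ℝ)) :
    Tendsto (fun n => expectedSmallOrbits n (π n) (π' n)) atTop (nhds 0) := by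
  have hprod : ∀ c : ℝ, 0 < c → ∀ᶠ n : ℕ in atTop,
      ((cycleCount (π n) 1 : ℝ) + √(cycleCount (π n) 2)) *
        (cycleCount (π' n) 1 + √(cycleCount (π' n) 2)) ≤ c * n := by
    intro c hc
    filter_upwards [h₂.bound hc] with n hn
    rwa [Real.norm_of_nonneg (by positivity), Real.norm_of_nonneg (by positivity)] at hn
  obtain ⟨G, hG, hG0, h⟩ := exists_summable_eventually_bound π π'
    (D := 1) (ε := 1 / 8) le_rfl (by norm_num)
    (by
      filter_upwards [h₁.bound one_pos] with n hn
      rwa [Real.norm_of_nonneg (by positivity), Real.norm_of_nonneg (by positivity)] at hn)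
    (hprod 1 one_pos)
    (by
      filter_upwards [hprod (1 / 4) (by norm_num)] with n hn
      refine add_le_of_mul_le (Nat.cast_nonneg _) (Nat.cast_nonneg _) ?_ ?_ (le_trans ?_ hn)
      · exact_mod_cast (by have := cycleCount_one_add_two_mul_le (π n); omega)
      · exact_mod_cast (by have := cycleCount_one_add_two_mul_le (π' n); omega)
      · gcongr <;> simp)
  let f : ℕ → ℕ → ℝ := fun n k => if 1 ≤ k ∧ 2 * k ≤ n then
    (#(invariantSets (π n) k) : ℝ) * #(invariantSets (π' n) k) / n.choose k else 0
  have hf0 : ∀ n k, 0 ≤ f n k := fun n k => by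
    simp only [f]; split_ifs <;> positivity
  have hlim : ∀ k, Tendsto (fun n => f n k) atTop (nhds 0) := by
    intro k
    rcases Nat.eq_zero_or_pos k with rfl | hk
    · simp [f]
    have hdiv := (isLittleO_crude_product π π' h₁ h₂).tendsto_div_nhds_zero
    have hupper := ((hdiv.mul_const (k : ℝ)).pow k).const_mul (Real.exp 6)
    rw [zero_mul, zero_pow hk.ne', mul_zero] at hupper
    refine squeeze_zero (fun n => hf0 n k) (fun n => ?_) hupper
    simp only [f]
    split_ifs with hkn
    · exact card_invariantSets_mul_card_le hk (by omega) _ _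
    · positivity
  have htsum : Tendsto (fun n => ∑' k, f n k) atTop (nhds 0) := by
    have := tendsto_tsum_of_dominated_convergence (f := f) (g := fun _ => 0) hG hlim (by
      filter_upwards [h] with n hn k
      rw [Real.norm_of_nonneg (hf0 n k)]
      simp only [f]
      split_ifs with hk
      · exact hn k hk.1 hk.2
      · exact hG0 k)
    simpa using this
  refine squeeze_zero (fun n => expectedSmallOrbits_nonneg _ _ _) (fun n => ?_) htsum
  refine (expectedSmallOrbits_le _ _ _).trans_eq ?_
  rw [tsum_eq_sum (s := Icc 1 (n / 2))]
  · refine Finset.sum_congr rfl fun k hk => ?_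
    rw [mem_Icc] at hk
    exact (if_pos ⟨hk.1, by omega⟩).symm
  · intro k hk
    rw [mem_Icc] at hk
    exact if_neg (by omega)

end

/-- (1) If `c₁ + c'₁ = o(n^{2/3})` and `(c₁ + c₂^{1/2})(c'₁ + c'₂^{1/2}) = o(n)` then
`E[Nₙ] → 0`; (2) if `c₁ + c'₁ = O(n^{2/3})`, `(c₁ + c₂^{1/2})(c'₁ + c'₂^{1/2}) = O(n)` and
`limsup (c₂ + c'₂)/n < 1` then `E[Nₙ]` is bounded. -/
theorem expected_small_orbits_bounds (π π' : (n : ℕ) → Equiv.Perm (Fin n)) :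
    (((fun n => (cycleCount (π n) 1 : ℝ) + (cycleCount (π' n) 1 : ℝ)) =o[atTop]
          fun n => (n : ℝ) ^ ((2 : ℝ) / 3)) →
      ((fun n => ((cycleCount (π n) 1 : ℝ) + Real.sqrt (cycleCount (π n) 2)) *
          ((cycleCount (π' n) 1 : ℝ) + Real.sqrt (cycleCount (π' n) 2))) =o[atTop]
          fun n => (n : ℝ)) →
      Tendsto (fun n => expectedSmallOrbits n (π n) (π' n)) atTop (nhds 0)) ∧
    (((fun n => (cycleCount (π n) 1 : ℝ) + (cycleCount (π' n) 1 : ℝ)) =O[atTop]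
          fun n => (n : ℝ) ^ ((2 : ℝ) / 3)) →
      ((fun n => ((cycleCount (π n) 1 : ℝ) + Real.sqrt (cycleCount (π n) 2)) *
          ((cycleCount (π' n) 1 : ℝ) + Real.sqrt (cycleCount (π' n) 2))) =O[atTop]
          fun n => (n : ℝ)) →
      limsup (fun n => ((cycleCount (π n) 2 : ℝ) + (cycleCount (π' n) 2 : ℝ)) / n) atTop < 1 →
      ∃ B : ℝ, ∀ n, |expectedSmallOrbits n (π n) (π' n)| ≤ B) := by
  exact ⟨tendsto_expectedSmallOrbits π π', bounded_expectedSmallOrbits π π'⟩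
end
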